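/- arXiv:1209.5409 — 4 statements merged into one kernel-verified Lean document; each statement's English description precedes it below -/
import Mathlib

section
/- Fix integers 0 < d < n and set r = d*(n−d). Let ((i₀,j₀), (i₁,j₁), …, (i_r,j_r)) be a path through 𝕀, and let μ₀ ⊆ μ₁ ⊆ ⋯ ⊆ μ_r be Young diagrams in Λ(d,n) such that μ_k has exactly k cells and μ_{k+1} is obtained from μ_k by adding one box for each k (so μ₀ = ∅ and μ_r = R). Then there exists exactly one cylindrical growth diagram γ with γ(i_k, j_k) = μ_k for all 0 ≤ k ≤ r. -/
/-- `ν` is obtained from `μ` by adding one box. -/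
def AddBox (μ ν : YoungDiagram) : Prop := μ ≤ ν ∧ ν.card = μ.card + 1

/-- Two cells of `ℕ × ℕ` are adjacent: `|a−a'| + |b−b'| = 1`. -/
def CellAdj (c c' : ℕ × ℕ) : Prop :=
  |(c.1 : ℤ) - (c'.1 : ℤ)| + |(c.2 : ℤ) - (c'.2 : ℤ)| = 1

/-- `μ ∈ Λ(d,n)`: every cell `(i,j)` of `μ` has `i < d` and `j < n−d`. -/
def InLambda (d n : ℕ) (μ : YoungDiagram) : Prop :=
  ∀ c ∈ μ.cells, c.1 < d ∧ c.2 < n - d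

/-- The full `d × m` rectangular Young diagram. -/
def rectYD (d m : ℕ) : YoungDiagram where
  cells := Finset.range d ×ˢ Finset.range m
  isLowerSet := by
    intro a b hba ha
    simp only [Finset.coe_product, Set.mem_prod, Finset.mem_coe, Finset.mem_range] at ha ⊢
    exact ⟨lt_of_le_of_lt hba.1 ha.1, lt_of_le_of_lt hba.2 ha.2⟩

/-- A cylindrical growth diagram for the parameters `d < n`, with `r = d*(n−d)`:
a map `γ` on `𝕀 = {(i,j) : i ≤ j ≤ i + r}` (normalized to `⊥` off `𝕀`) valued in
`Λ(d,n)`, such that `γ i j` has `j − i` cells, `γ i (j+1)` and `γ (i−1) j` are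
obtained from `γ i j` by adding one box, and whenever the two cells of
`γ (i−1) (j+1) \ γ i j` are nonadjacent, `γ i (j+1) ≠ γ (i−1) j`. -/
structure CGD (d n : ℕ) where
  γ : ℤ → ℤ → YoungDiagram
  junk : ∀ i j : ℤ, ¬ (i ≤ j ∧ j ≤ i + ((d * (n - d) : ℕ) : ℤ)) → γ i j = ⊥
  lambda : ∀ i j : ℤ, i ≤ j → j ≤ i + ((d * (n - d) : ℕ) : ℤ) → InLambda d n (γ i j)
  card_eq : ∀ i j : ℤ, i ≤ j → j ≤ i + ((d * (n - d) : ℕ) : ℤ) →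
    ((γ i j).card : ℤ) = j - i
  grow_right : ∀ i j : ℤ, i ≤ j → j + 1 ≤ i + ((d * (n - d) : ℕ) : ℤ) →
    AddBox (γ i j) (γ i (j + 1))
  grow_up : ∀ i j : ℤ, i ≤ j → j ≤ (i - 1) + ((d * (n - d) : ℕ) : ℤ) →
    AddBox (γ i j) (γ (i - 1) j)
  nonadj : ∀ i j : ℤ, i ≤ j → j + 1 ≤ (i - 1) + ((d * (n - d) : ℕ) : ℤ) →
    (∃ c₁ ∈ (γ (i - 1) (j + 1)).cells \ (γ i j).cells,
      ∃ c₂ ∈ (γ (i - 1) (j + 1)).cells \ (γ i j).cells, c₁ ≠ c₂ ∧ ¬ CellAdj c₁ c₂) →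
    γ i (j + 1) ≠ γ (i - 1) j

/-- `x` sits strictly between `lo` and `hi` in a chain adding one box at a time. -/
def Between (lo x hi : YoungDiagram) : Prop := AddBox lo x ∧ AddBox x hi

theorem AddBox.exists_cell {μ ν : YoungDiagram} (h : AddBox μ ν) :
    ∃ a, a ∉ μ.cells ∧ ν.cells = insert a μ.cells := by
  have hsub : μ.cells ⊆ ν.cells := YoungDiagram.cells_subset_iff.2 h.1
  have hc : (ν.cells \ μ.cells).card = 1 := by
    have h1 := Finset.card_sdiff_add_card_eq_card hsub
    have h2 : ν.cells.card = μ.cells.card + 1 := h.2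
    omega
  obtain ⟨a, ha⟩ := Finset.card_eq_one.1 hc
  refine ⟨a, ?_, ?_⟩
  · have : a ∈ ν.cells \ μ.cells := by simp [ha]
    exact (Finset.mem_sdiff.1 this).2
  · rw [← Finset.sdiff_union_of_subset hsub, ha]
    rfl

theorem Between.exists_cell {lo x hi : YoungDiagram} (h : Between lo x hi) :
    ∃ a ∈ hi.cells \ lo.cells, x.cells = insert a lo.cells := by
  obtain ⟨a, ha, hx⟩ := h.1.exists_cell
  refine ⟨a, Finset.mem_sdiff.2 ⟨?_, ha⟩, hx⟩
  exact YoungDiagram.cells_subset_iff.2 h.2.1 (by simp [hx])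

theorem Between.card_sdiff {lo x hi : YoungDiagram} (h : Between lo x hi) :
    (hi.cells \ lo.cells).card = 2 := by
  have hsub : lo.cells ⊆ hi.cells := YoungDiagram.cells_subset_iff.2 (h.1.1.trans h.2.1)
  have h0 := Finset.card_sdiff_add_card_eq_card hsub
  have h1 : x.cells.card = lo.cells.card + 1 := h.1.2
  have h2 : hi.cells.card = x.cells.card + 1 := h.2.2
  omega

theorem Finset.eq_or_eq_of_card_eq_two {α : Type*} [DecidableEq α] {s : Finset α}
    (hs : s.card = 2) {a b c : α} (ha : a ∈ s) (hb : b ∈ s) (hc : c ∈ s) (hab : a ≠ b) :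
    c = a ∨ c = b := by
  have h : ({a, b} : Finset α) = s := by
    apply Finset.eq_of_subset_of_card_le
    · simp [Finset.insert_subset_iff, ha, hb]
    · rw [hs, Finset.card_pair hab]
  simpa [← h] using hc

/-- There are at most two diagrams between two given ones. -/
theorem Between.eq_of_ne {lo x y z hi : YoungDiagram} (hx : Between lo x hi)
    (hy : Between lo y hi) (hz : Between lo z hi) (hyx : y ≠ x) (hzx : z ≠ x) : z = y := by
  obtain ⟨a, ha, hxa⟩ := hx.exists_cell
  obtain ⟨b, hb, hyb⟩ := hy.exists_cell
  obtain ⟨c, hc, hzc⟩ := hz.exists_cell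
  have hab : a ≠ b := fun h => hyx (YoungDiagram.ext (by rw [hyb, hxa, h]))
  rcases Finset.eq_or_eq_of_card_eq_two hx.card_sdiff ha hb hc hab with h | h
  · exact absurd (YoungDiagram.ext (by rw [hzc, hxa, h])) hzx
  · exact YoungDiagram.ext (by rw [hzc, hyb, h])

/-- The skew shape `hi / lo` contains two distinct nonadjacent cells. -/
def HasNonadj (lo hi : YoungDiagram) : Prop :=
  ∃ c₁ ∈ hi.cells \ lo.cells, ∃ c₂ ∈ hi.cells \ lo.cells, c₁ ≠ c₂ ∧ ¬ CellAdj c₁ c₂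

theorem CellAdj.le_or_le {a b : ℕ × ℕ} (h : CellAdj a b) : a ≤ b ∨ b ≤ a := by
  unfold CellAdj at h
  simp only [Prod.le_def]
  grind

theorem CellAdj.symm {a b : ℕ × ℕ} (h : CellAdj a b) : CellAdj b a := by
  unfold CellAdj at h ⊢
  rw [abs_sub_comm (b.1 : ℤ), abs_sub_comm (b.2 : ℤ)]
  exact h

theorem cellAdj_succ_fst (i j : ℕ) : CellAdj (i, j) (i + 1, j) := by
  simp [CellAdj]

theorem cellAdj_succ_snd (i j : ℕ) : CellAdj (i, j) (i, j + 1) := by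
  simp [CellAdj]

theorem Between.exists_ne_of_hasNonadj {lo x hi : YoungDiagram} (hx : Between lo x hi)
    (h : HasNonadj lo hi) : ∃ y, Between lo y hi ∧ y ≠ x := by
  obtain ⟨a, ha, hxa⟩ := hx.exists_cell
  obtain ⟨b, hb, hba, hadj⟩ : ∃ b ∈ hi.cells \ lo.cells, b ≠ a ∧ ¬ CellAdj a b := by
    obtain ⟨c₁, h₁, c₂, h₂, hne, hnadj⟩ := h
    rcases Finset.eq_or_eq_of_card_eq_two hx.card_sdiff h₁ h₂ ha hne with rfl | rfl
    · exact ⟨c₂, h₂, hne.symm, hnadj⟩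
    · exact ⟨c₁, h₁, hne, fun hc => hnadj hc.symm⟩
  have mem_sdiff : ∀ {v}, v ∈ hi.cells → v ∉ lo.cells → v = a ∨ v = b := fun hv hv' =>
    Finset.eq_or_eq_of_card_eq_two hx.card_sdiff ha hb (Finset.mem_sdiff.2 ⟨hv, hv'⟩) hba.symm
  rw [Finset.mem_sdiff] at ha hb
  have hlt : ∀ z, a ≤ z → z ≤ b → z = a ∨ z = b := fun z haz hzb =>
    mem_sdiff (hi.isLowerSet hzb hb.1) (fun hz => ha.2 (lo.isLowerSet haz hz))
  have hnle : ¬ a ≤ b := by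
    intro hab
    obtain ⟨a₁, a₂⟩ := a
    obtain ⟨b₁, b₂⟩ := b
    simp only [Prod.mk_le_mk] at hab
    have hcases : a₁ < b₁ ∨ a₂ < b₂ := by
      by_contra! hcon
      exact hba (Prod.ext (le_antisymm hcon.1 hab.1) (le_antisymm hcon.2 hab.2))
    rcases hcases with hl | hl
    · rcases hlt (a₁ + 1, a₂) (by simp) (by simp only [Prod.mk_le_mk]; omega) with hz | hz
      · simp at hz
      · exact hadj (hz ▸ cellAdj_succ_fst a₁ a₂)
    · rcases hlt (a₁, a₂ + 1) (by simp) (by simp only [Prod.mk_le_mk]; omega) with hz | hz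
      · simp at hz
      · exact hadj (hz ▸ cellAdj_succ_snd a₁ a₂)
  have hlower : IsLowerSet ((insert b lo.cells : Finset (ℕ × ℕ)) : Set (ℕ × ℕ)) := by
    intro u v hvu hu
    simp only [Finset.coe_insert, Set.mem_insert_iff, Finset.mem_coe] at hu ⊢
    rcases hu with rfl | hu
    · by_contra! hv
      rcases mem_sdiff (hi.isLowerSet hvu hb.1) hv.2 with rfl | rfl
      · exact hnle hvu
      · exact hv.1 rfl
    · exact Or.inr (lo.isLowerSet hvu hu)
  have hcard : (insert b lo.cells).card = lo.cells.card + 1 := Finset.card_insert_of_notMem hb.2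
  have hlo : lo.cells ⊆ hi.cells := YoungDiagram.cells_subset_iff.2 (hx.1.1.trans hx.2.1)
  refine ⟨⟨insert b lo.cells, hlower⟩, ⟨⟨?_, hcard⟩, ⟨?_, ?_⟩⟩, ?_⟩
  · exact YoungDiagram.cells_subset_iff.1 (Finset.subset_insert _ _)
  · exact YoungDiagram.cells_subset_iff.1 (Finset.insert_subset hb.1 hlo)
  · have h1 : hi.card = x.card + 1 := hx.2.2
    have h2 : x.card = lo.card + 1 := hx.1.2
    have h3 : (insert b lo.cells).card + 1 = lo.card + 1 + 1 := by rw [hcard]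
    rw [h1, h2]
    exact h3.symm
  · intro heq
    have : b ∈ x.cells := heq ▸ Finset.mem_insert_self b lo.cells
    rw [hxa, Finset.mem_insert] at this
    exact this.elim hba hb.2

theorem Between.hasNonadj_of_ne {lo x y hi : YoungDiagram} (hx : Between lo x hi)
    (hy : Between lo y hi) (hyx : y ≠ x) : HasNonadj lo hi := by
  obtain ⟨a, ha, hxa⟩ := hx.exists_cell
  obtain ⟨b, hb, hyb⟩ := hy.exists_cell
  have hab : a ≠ b := fun h => hyx (YoungDiagram.ext (by rw [hyb, hxa, h]))
  refine ⟨a, ha, b, hb, hab, fun hadj => ?_⟩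
  rw [Finset.mem_sdiff] at ha hb
  rcases hadj.le_or_le with hle | hle
  · have : a ∈ y.cells := y.isLowerSet hle (by simp [hyb])
    rw [hyb, Finset.mem_insert] at this
    exact this.elim hab ha.2
  · have : b ∈ x.cells := x.isLowerSet hle (by simp [hxa])
    rw [hxa, Finset.mem_insert] at this
    exact this.elim hab.symm hb.2

open Classical in
/-- The local rule: the other diagram between `lo` and `hi` if there is one, else `x` itself. -/
noncomputable def localFlip (lo x hi : YoungDiagram) : YoungDiagram :=
  if h : Between lo x hi ∧ ∃ y, Between lo y hi ∧ y ≠ x then h.2.choose else x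

theorem localFlip_eq {lo x y hi : YoungDiagram} (hx : Between lo x hi) (hy : Between lo y hi)
    (h : HasNonadj lo hi → x ≠ y) : localFlip lo x hi = y := by
  unfold localFlip
  split_ifs with hex
  · have hs := hex.2.choose_spec
    exact hx.eq_of_ne hy hs.1 (h (hx.hasNonadj_of_ne hs.1 hs.2)).symm hs.2
  · by_contra hne
    exact hex ⟨hx, y, hy, fun h' => hne h'.symm⟩

theorem Between.localFlip {lo x hi : YoungDiagram} (hx : Between lo x hi) :
    Between lo (localFlip lo x hi) hi := by
  unfold _root_.localFlip
  split_ifs with hex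
  · exact hex.2.choose_spec.1
  · exact hx

theorem Between.localFlip_ne {lo x hi : YoungDiagram} (hx : Between lo x hi)
    (h : HasNonadj lo hi) : _root_.localFlip lo x hi ≠ x := by
  have hex : Between lo x hi ∧ ∃ y, Between lo y hi ∧ y ≠ x :=
    ⟨hx, hx.exists_ne_of_hasNonadj h⟩
  unfold _root_.localFlip
  rw [dif_pos hex]
  exact hex.2.choose_spec.2

theorem localFlip_localFlip (lo x hi : YoungDiagram) :
    localFlip lo (localFlip lo x hi) hi = x := by
  by_cases hx : Between lo x hi
  · exact localFlip_eq hx.localFlip hx hx.localFlip_ne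
  · have h : localFlip lo x hi = x := dif_neg (fun h => hx h.1)
    rw [h, h]

/-- The Bender–Knuth involution at level `k + 1` on sequences of diagrams. -/
noncomputable def benderKnuth (k : ℕ) : Equiv.Perm (ℕ → YoungDiagram) :=
  Function.Involutive.toPerm
    (fun c => Function.update c (k + 1) (localFlip (c k) (c (k + 1)) (c (k + 2))))
    (fun c => by simp [localFlip_localFlip])

theorem benderKnuth_apply (k : ℕ) (c : ℕ → YoungDiagram) :
    benderKnuth k c =
      Function.update c (k + 1) (localFlip (c k) (c (k + 1)) (c (k + 2))) := rfl

theorem benderKnuth_symm (k : ℕ) : (benderKnuth k)⁻¹ = benderKnuth k := rfl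

/-- The composite of the Bender–Knuth involutions at levels `1, …, k`, in this order. -/
noncomputable def partialPromotion : ℕ → Equiv.Perm (ℕ → YoungDiagram)
  | 0 => 1
  | k + 1 => benderKnuth k * partialPromotion k

theorem partialPromotion_succ_apply (k : ℕ) (c : ℕ → YoungDiagram) :
    partialPromotion (k + 1) c = benderKnuth k (partialPromotion k c) := rfl

theorem partialPromotion_of_lt {k j : ℕ} (h : k < j) (c : ℕ → YoungDiagram) :
    partialPromotion k c j = c j := by
  induction k with
  | zero => rfl
  | succ k ih =>
    rw [partialPromotion_succ_apply, benderKnuth_apply, Function.update_of_ne (by omega),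
      ih (by omega)]

theorem partialPromotion_of_le {j k m : ℕ} (hj : j ≤ k) (hk : k ≤ m) (c : ℕ → YoungDiagram) :
    partialPromotion m c j = partialPromotion k c j := by
  induction m, hk using Nat.le_induction with
  | base => rfl
  | succ m hm ih =>
    rw [partialPromotion_succ_apply, benderKnuth_apply, Function.update_of_ne (by omega), ih]

theorem partialPromotion_succ {k m : ℕ} (h : k + 1 ≤ m) (c : ℕ → YoungDiagram) :
    partialPromotion m c (k + 1) =
      localFlip (partialPromotion m c k) (c (k + 1)) (c (k + 2)) := by
  rw [partialPromotion_of_le le_rfl h, partialPromotion_succ_apply, benderKnuth_apply,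
    Function.update_self, partialPromotion_of_lt (by omega : k < k + 1),
    partialPromotion_of_lt (by omega : k < k + 2), partialPromotion_of_le le_rfl (by omega : k ≤ m)]

/-- A maximal chain of diagrams in `Λ(d,n)`, extended by `⊥` beyond level `d * (n - d)`. -/
structure IsBoxChain (d n : ℕ) (c : ℕ → YoungDiagram) : Prop where
  lambda : ∀ k ≤ d * (n - d), InLambda d n (c k)
  card_eq : ∀ k ≤ d * (n - d), (c k).card = k
  addBox : ∀ k < d * (n - d), AddBox (c k) (c (k + 1))
  junk : ∀ k, d * (n - d) < k → c k = ⊥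

theorem InLambda.eq_rectYD {d n : ℕ} {μ : YoungDiagram} (h : InLambda d n μ)
    (hc : μ.card = d * (n - d)) : μ = rectYD d (n - d) := by
  apply YoungDiagram.ext
  apply Finset.eq_of_subset_of_card_le
  · intro c hcμ
    simpa [rectYD] using h c hcμ
  · have : (rectYD d (n - d)).cells.card = d * (n - d) := by simp [rectYD]
    rw [this]
    exact hc.ge

theorem YoungDiagram.eq_bot_of_card {μ : YoungDiagram} (h : μ.card = 0) : μ = ⊥ :=
  YoungDiagram.ext (by simpa using Finset.card_eq_zero.1 h)

theorem IsBoxChain.between {d n : ℕ} {c : ℕ → YoungDiagram} (hc : IsBoxChain d n c) {k : ℕ}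
    (hk : k + 2 ≤ d * (n - d)) : Between (c k) (c (k + 1)) (c (k + 2)) :=
  ⟨hc.addBox k (by omega), hc.addBox (k + 1) (by omega)⟩

theorem InLambda.mono {d n : ℕ} {μ ν : YoungDiagram} (h : InLambda d n ν) (hle : μ ≤ ν) :
    InLambda d n μ := fun c hc => h c (YoungDiagram.cells_subset_iff.2 hle hc)

theorem IsBoxChain.benderKnuth {d n : ℕ} {c : ℕ → YoungDiagram} (hc : IsBoxChain d n c) {k : ℕ}
    (hk : k + 2 ≤ d * (n - d)) : IsBoxChain d n (benderKnuth k c) := by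
  have hb := (hc.between hk).localFlip
  rw [benderKnuth_apply]
  constructor
  · intro j hj
    rcases eq_or_ne j (k + 1) with rfl | hne
    · rw [Function.update_self]
      exact (hc.lambda _ hk).mono hb.2.1
    · rw [Function.update_of_ne hne]
      exact hc.lambda j hj
  · intro j hj
    rcases eq_or_ne j (k + 1) with rfl | hne
    · rw [Function.update_self, hb.1.2, hc.card_eq k (by omega)]
    · rw [Function.update_of_ne hne]
      exact hc.card_eq j hj
  · intro j hj
    rcases eq_or_ne j (k + 1) with rfl | hne
    · rw [Function.update_self, Function.update_of_ne (by omega)]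
      exact hb.2
    · rw [Function.update_of_ne hne]
      rcases eq_or_ne j k with rfl | hne'
      · rw [Function.update_self]
        exact hb.1
      · rw [Function.update_of_ne (by omega)]
        exact hc.addBox j hj
  · intro j hj
    rw [Function.update_of_ne (by omega)]
    exact hc.junk j hj

theorem IsBoxChain.partialPromotion {d n : ℕ} {c : ℕ → YoungDiagram} (hc : IsBoxChain d n c)
    {k : ℕ} (hk : k + 1 ≤ d * (n - d)) : IsBoxChain d n (partialPromotion k c) := by
  induction k with
  | zero => exact hc
  | succ k ih => exact (ih (by omega)).benderKnuth hk

theorem IsBoxChain.partialPromotion_inv {d n : ℕ} {c : ℕ → YoungDiagram} {k : ℕ}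
    (hk : k + 1 ≤ d * (n - d)) (hc : IsBoxChain d n c) :
    IsBoxChain d n ((_root_.partialPromotion k)⁻¹ c) := by
  induction k generalizing c with
  | zero => exact hc
  | succ k ih =>
    have h : (_root_.partialPromotion (k + 1))⁻¹ c =
        (_root_.partialPromotion k)⁻¹ (_root_.benderKnuth k c) := by
      rw [_root_.partialPromotion, mul_inv_rev, benderKnuth_symm]
      rfl
    rw [h]
    exact ih (by omega) (hc.benderKnuth hk)

/-- Promotion: the passage from one row of a cylindrical growth diagram to the next. -/
noncomputable def promotion (d n : ℕ) : Equiv.Perm (ℕ → YoungDiagram) :=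
  partialPromotion (d * (n - d) - 1)

theorem IsBoxChain.promotion_zpow {d n : ℕ} {c : ℕ → YoungDiagram} (hr : 0 < d * (n - d))
    (hc : IsBoxChain d n c) (m : ℤ) : IsBoxChain d n ((promotion d n ^ m) c) := by
  induction m with
  | zero => exact hc
  | succ i ih =>
    rw [zpow_add_one, (Commute.zpow_self _ _).eq, Equiv.Perm.mul_apply]
    exact ih.partialPromotion (by omega)
  | pred i ih =>
    rw [sub_eq_add_neg, add_comm, zpow_add, zpow_neg_one, Equiv.Perm.mul_apply]
    exact IsBoxChain.partialPromotion_inv (by omega) ih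

theorem IsBoxChain.addBox_promotion {d n : ℕ} {c : ℕ → YoungDiagram} (hc : IsBoxChain d n c)
    {k : ℕ} (hk : k + 1 ≤ d * (n - d)) : AddBox (promotion d n c k) (c (k + 1)) := by
  have h := (hc.partialPromotion hk).addBox k hk
  rw [partialPromotion_of_lt (by omega : k < k + 1)] at h
  rwa [promotion, partialPromotion_of_le le_rfl (by omega : k ≤ d * (n - d) - 1)]

theorem promotion_succ {d n k : ℕ} (hk : k + 2 ≤ d * (n - d)) (c : ℕ → YoungDiagram) :
    promotion d n c (k + 1) = localFlip (promotion d n c k) (c (k + 1)) (c (k + 2)) :=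
  partialPromotion_succ (by omega) c

/-- The sequence of diagrams in row `i` of a cylindrical growth diagram. -/
def CGD.row {d n : ℕ} (g : CGD d n) (i : ℤ) (k : ℕ) : YoungDiagram := g.γ i (i + k)

theorem CGD.ext_row {d n : ℕ} {g g' : CGD d n} (h : ∀ i, g.row i = g'.row i) : g = g' := by
  have hγ : g.γ = g'.γ := by
    funext i j
    by_cases hij : i ≤ j ∧ j ≤ i + ((d * (n - d) : ℕ) : ℤ)
    · have := congrFun (h i) (j - i).toNat
      have hj : i + ((j - i).toNat : ℤ) = j := by omega
      simpa only [CGD.row, hj] using this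
    · rw [g.junk i j hij, g'.junk i j hij]
  cases g
  cases g'
  congr

theorem CGD.isBoxChain_row {d n : ℕ} (g : CGD d n) (i : ℤ) : IsBoxChain d n (g.row i) where
  lambda k hk := g.lambda _ _ (by omega) (by omega)
  card_eq k hk := by
    have := g.card_eq i (i + k) (by omega) (by omega)
    simp only [CGD.row]
    omega
  addBox k hk := by
    have := g.grow_right i (i + k) (by omega) (by omega)
    simpa only [CGD.row, Nat.cast_add, Nat.cast_one, add_assoc] using this
  junk k hk := g.junk _ _ (by omega)

theorem CGD.between_row {d n : ℕ} (g : CGD d n) (i : ℤ) {k : ℕ} (hk : k + 2 ≤ d * (n - d)) :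
    Between (g.row (i + 1) k) (g.row (i + 1) (k + 1)) (g.row i (k + 2)) ∧
    Between (g.row (i + 1) k) (g.row i (k + 1)) (g.row i (k + 2)) ∧
    (HasNonadj (g.row (i + 1) k) (g.row i (k + 2)) →
      g.row (i + 1) (k + 1) ≠ g.row i (k + 1)) := by
  have up : ∀ m : ℕ, m + 1 ≤ d * (n - d) → AddBox (g.row (i + 1) m) (g.row i (m + 1)) := by
    intro m hm
    have h := g.grow_up (i + 1) (i + 1 + m) (by omega) (by omega)
    rw [add_sub_cancel_right] at h
    have e : i + ((m + 1 : ℕ) : ℤ) = i + 1 + m := by push_cast; ring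
    simpa only [CGD.row, e] using h
  refine ⟨⟨(g.isBoxChain_row _).addBox k (by omega), up _ (by omega)⟩,
    ⟨up _ (by omega), (g.isBoxChain_row _).addBox (k + 1) (by omega)⟩, ?_⟩
  have h := g.nonadj (i + 1) (i + 1 + k) (by omega) (by omega)
  rw [add_sub_cancel_right] at h
  have e₁ : i + ((k + 1 : ℕ) : ℤ) = i + 1 + k := by push_cast; ring
  have e₂ : i + ((k + 2 : ℕ) : ℤ) = i + 1 + k + 1 := by push_cast; ring
  have e₃ : i + 1 + ((k + 1 : ℕ) : ℤ) = i + 1 + k + 1 := by push_cast; ring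
  simpa only [CGD.row, HasNonadj, e₁, e₂, e₃] using h

theorem CGD.localFlip_row {d n : ℕ} (g : CGD d n) (i : ℤ) {k : ℕ} (hk : k + 2 ≤ d * (n - d)) :
    localFlip (g.row (i + 1) k) (g.row i (k + 1)) (g.row i (k + 2)) = g.row (i + 1) (k + 1) := by
  obtain ⟨h₁, h₂, h₃⟩ := g.between_row i hk
  exact localFlip_eq h₂ h₁ (fun h => (h₃ h).symm)

theorem IsBoxChain.eq_top {d n : ℕ} {c : ℕ → YoungDiagram} (hc : IsBoxChain d n c) :
    c (d * (n - d)) = rectYD d (n - d) :=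
  (hc.lambda _ le_rfl).eq_rectYD (hc.card_eq _ le_rfl)

theorem IsBoxChain.eq_bot {d n : ℕ} {c : ℕ → YoungDiagram} (hc : IsBoxChain d n c) : c 0 = ⊥ :=
  YoungDiagram.eq_bot_of_card (hc.card_eq 0 (Nat.zero_le _))

theorem CGD.row_add_one {d n : ℕ} (hr : 0 < d * (n - d)) (g : CGD d n) (i : ℤ) :
    g.row (i + 1) = promotion d n (g.row i) := by
  have hp : IsBoxChain d n (promotion d n (g.row i)) :=
    (g.isBoxChain_row i).partialPromotion (by omega)
  have hrow := g.isBoxChain_row (i + 1)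
  funext k
  induction k with
  | zero => rw [hp.eq_bot, hrow.eq_bot]
  | succ k ih =>
    rcases lt_trichotomy (k + 1) (d * (n - d)) with hk | hk | hk
    · rw [promotion_succ hk, ← ih, g.localFlip_row i hk]
    · rw [hk, hp.eq_top, hrow.eq_top]
    · rw [hp.junk _ hk, hrow.junk _ hk]

theorem CGD.ext_of_row_eq {d n : ℕ} (hr : 0 < d * (n - d)) {g g' : CGD d n} (N : ℤ)
    (h : g.row N = g'.row N) : g = g' := by
  apply CGD.ext_row
  intro i
  induction i using Int.inductionOn' (b := N) with
  | zero => exact h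
  | succ k _ ih => rw [g.row_add_one hr, g'.row_add_one hr, ih]
  | pred k _ ih =>
    apply (promotion d n).injective
    rw [← g.row_add_one hr, ← g'.row_add_one hr, sub_add_cancel, ih]

theorem CGD.exists_row_eq {d n : ℕ} (hr : 0 < d * (n - d)) {c : ℕ → YoungDiagram}
    (hc : IsBoxChain d n c) (N : ℤ) : ∃ g : CGD d n, g.row N = c := by
  set D : ℤ → ℕ → YoungDiagram := fun i => (promotion d n ^ (i - N)) c with hD
  have hchain : ∀ i, IsBoxChain d n (D i) := fun i => hc.promotion_zpow hr _
  have hsucc : ∀ i, D i = promotion d n (D (i - 1)) := by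
    intro i
    simp only [hD]
    rw [← Equiv.Perm.mul_apply, ← zpow_one_add]
    congr 2
    ring
  have hval : ∀ (i j : ℤ) (k : ℕ), j = i + k → k ≤ d * (n - d) →
      (if i ≤ j ∧ j ≤ i + ((d * (n - d) : ℕ) : ℤ) then D i (j - i).toNat else ⊥) = D i k := by
    intro i j k hj hk
    rw [if_pos (by omega)]
    congr 1
    omega
  refine ⟨⟨fun i j => if i ≤ j ∧ j ≤ i + ((d * (n - d) : ℕ) : ℤ) then D i (j - i).toNat else ⊥,
    ?_, ?_, ?_, ?_, ?_, ?_⟩, ?_⟩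
  · intro i j h
    rw [if_neg h]
  · intro i j h₁ h₂
    obtain ⟨k, rfl⟩ := Int.le.dest h₁
    rw [hval i _ k rfl (by omega)]
    exact (hchain i).lambda k (by omega)
  · intro i j h₁ h₂
    obtain ⟨k, rfl⟩ := Int.le.dest h₁
    rw [hval i _ k rfl (by omega), (hchain i).card_eq k (by omega)]
    ring
  · intro i j h₁ h₂
    obtain ⟨k, rfl⟩ := Int.le.dest h₁
    rw [hval i _ k rfl (by omega), hval i _ (k + 1) (by push_cast; ring) (by omega)]
    exact (hchain i).addBox k (by omega)
  · intro i j h₁ h₂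
    obtain ⟨k, rfl⟩ := Int.le.dest h₁
    rw [hval i _ k rfl (by omega), hval (i - 1) _ (k + 1) (by push_cast; ring) (by omega),
      hsucc i]
    exact (hchain (i - 1)).addBox_promotion (by omega)
  · intro i j h₁ h₂
    obtain ⟨k, rfl⟩ := Int.le.dest h₁
    rw [hval i _ k rfl (by omega), hval (i - 1) (i + k) (k + 1) (by push_cast; ring) (by omega),
      hval (i - 1) (i + k + 1) (k + 2) (by push_cast; ring) (by omega),
      hval i (i + k + 1) (k + 1) (by push_cast; ring) (by omega), hsucc i,
      promotion_succ (by omega)]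
    exact Between.localFlip_ne ⟨(hchain (i - 1)).addBox_promotion (by omega),
      (hchain (i - 1)).addBox (k + 1) (by omega)⟩
  · funext k
    simp only [CGD.row]
    by_cases hk : k ≤ d * (n - d)
    · rw [hval N _ k rfl hk]
      simp [hD]
    · rw [if_neg (by omega), hc.junk k (by omega)]

theorem CGD.existsUnique_row_eq {d n : ℕ} (hr : 0 < d * (n - d)) {c : ℕ → YoungDiagram}
    (hc : IsBoxChain d n c) (N : ℤ) : ∃! g : CGD d n, g.row N = c := by
  obtain ⟨g, hg⟩ := CGD.exists_row_eq hr hc N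
  exact ⟨g, hg, fun g' hg' => CGD.ext_of_row_eq hr N (hg'.trans hg.symm)⟩

/-- The row index `a k` at level `k` stays the same or drops by one at each step. -/
def IsLevelPath (r : ℕ) (a : ℕ → ℤ) : Prop :=
  ∀ k < r, a (k + 1) = a k ∨ a (k + 1) = a k - 1

theorem IsLevelPath.le_zero {r : ℕ} {a : ℕ → ℤ} (ha : IsLevelPath r a) {k : ℕ} (hk : k ≤ r) :
    a k ≤ a 0 := by
  induction k with
  | zero => exact le_rfl
  | succ k ih =>
    have := ih (by omega)
    rcases ha k hk with h | h <;> omega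

/-- A level path is either constant or has a last descent. -/
theorem IsLevelPath.const_or_last_descent {r : ℕ} {a : ℕ → ℤ} (ha : IsLevelPath r a) :
    (∀ k ≤ r, a k = a 0) ∨
      ∃ k < r, a k = a (k + 1) + 1 ∧ (k + 1 < r → a (k + 2) = a (k + 1)) := by
  induction r with
  | zero => exact Or.inl fun k hk => by rw [Nat.le_zero.1 hk]
  | succ r ih =>
    rcases ha r (Nat.lt_succ_self r) with h | h
    · rcases ih (fun k hk => ha k (by omega)) with hc | ⟨k, hk, hd, hl⟩
      · left
        intro k hk
        rcases Nat.lt_or_ge r k with hlt | hle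
        · obtain rfl : k = r + 1 := by omega
          rw [h, hc r le_rfl]
        · exact hc k hle
      · refine Or.inr ⟨k, by omega, hd, fun hk' => ?_⟩
        rcases Nat.lt_or_ge (k + 1) r with hlt | hle
        · exact hl hlt
        · obtain rfl : k + 1 = r := by omega
          exact h
    · exact Or.inr ⟨r, by omega, by omega, fun h => by omega⟩

theorem CGD.row_benderKnuth_iff {d n : ℕ} {a : ℕ → ℤ} {c : ℕ → YoungDiagram} {k : ℕ}
    (hk : k + 2 ≤ d * (n - d)) (hdesc : a k = a (k + 1) + 1) (hflat : a (k + 2) = a (k + 1))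
    (g : CGD d n) :
    (∀ j ≤ d * (n - d), g.row (Function.update a (k + 1) (a k) j) j = benderKnuth k c j) ↔
      ∀ j ≤ d * (n - d), g.row (a j) j = c j := by
  have off : ∀ {j}, j ≠ k + 1 → ((g.row (Function.update a (k + 1) (a k) j) j =
      benderKnuth k c j) ↔ g.row (a j) j = c j) := by
    intro j hj
    rw [benderKnuth_apply, Function.update_of_ne hj, Function.update_of_ne hj]
  have key : g.row (a k) k = c k → g.row (a (k + 2)) (k + 2) = c (k + 2) →
      ((g.row (Function.update a (k + 1) (a k) (k + 1)) (k + 1) = benderKnuth k c (k + 1)) ↔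
        g.row (a (k + 1)) (k + 1) = c (k + 1)) := by
    intro h₀ h₂
    have hflip := g.localFlip_row (a (k + 1)) hk
    rw [← hdesc, h₀, ← hflat, h₂, hflat] at hflip
    rw [benderKnuth_apply, Function.update_self, Function.update_self, ← hflip]
    constructor
    · intro h
      rw [← localFlip_localFlip (c k) (g.row _ _), h, localFlip_localFlip]
    · intro h
      rw [h]
  constructor
  · intro h j hj
    rcases eq_or_ne j (k + 1) with rfl | hne
    · exact (key ((off (by omega)).1 (h k (by omega))) ((off (by omega)).1 (h _ hk))).1 (h _ hj)
    · exact (off hne).1 (h j hj)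
  · intro h j hj
    rcases eq_or_ne j (k + 1) with rfl | hne
    · exact (key (h k (by omega)) (h _ hk)).2 (h _ hj)
    · exact (off hne).2 (h j hj)

theorem CGD.row_update_top_iff {d n : ℕ} {a : ℕ → ℤ} {c : ℕ → YoungDiagram}
    (hc : IsBoxChain d n c) (N : ℤ) (g : CGD d n) :
    (∀ j ≤ d * (n - d), g.row (Function.update a (d * (n - d)) N j) j = c j) ↔
      ∀ j ≤ d * (n - d), g.row (a j) j = c j := by
  refine forall₂_congr fun j _ => ?_
  rcases eq_or_ne j (d * (n - d)) with rfl | hne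
  · simp only [hc.eq_top, (g.isBoxChain_row _).eq_top]
  · rw [Function.update_of_ne hne]

theorem IsLevelPath.existsUnique_cgd {d n : ℕ} (hr : 0 < d * (n - d)) {a : ℕ → ℤ}
    {c : ℕ → YoungDiagram} (ha : IsLevelPath (d * (n - d)) a) (hc : IsBoxChain d n c) :
    ∃! g : CGD d n, ∀ k ≤ d * (n - d), g.row (a k) k = c k := by
  induction hm : ∑ k ∈ Finset.range (d * (n - d) + 1), (a 0 - a k).toNat using
    Nat.strong_induction_on generalizing a c with
  | _ m ih =>
  subst hm
  rcases ha.const_or_last_descent with hconst | ⟨k, hk, hdesc, hflat⟩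
  · refine (existsUnique_congr fun g => ?_).1 (CGD.existsUnique_row_eq hr hc (a 0))
    constructor
    · intro h k hk
      rw [hconst k hk, h]
    · intro h
      funext k
      by_cases hk : k ≤ d * (n - d)
      · rw [← h k hk, hconst k hk]
      · rw [hc.junk k (by omega), (g.isBoxChain_row _).junk k (by omega)]
  · have hak : a k ≤ a 0 := ha.le_zero hk.le
    have hpath : IsLevelPath (d * (n - d)) (Function.update a (k + 1) (a k)) := by
      intro j hj
      rcases eq_or_ne j (k + 1) with rfl | hne
      · have : a (k + 1 + 1) = a (k + 1) := hflat hj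
        rw [Function.update_self, Function.update_of_ne (by omega)]
        omega
      · rcases eq_or_ne j k with rfl | hne'
        · rw [Function.update_self, Function.update_of_ne hne]
          exact Or.inl rfl
        · rw [Function.update_of_ne hne, Function.update_of_ne (by omega)]
          exact ha j hj
    have hlt : ∑ j ∈ Finset.range (d * (n - d) + 1),
        (Function.update a (k + 1) (a k) 0 - Function.update a (k + 1) (a k) j).toNat <
        ∑ j ∈ Finset.range (d * (n - d) + 1), (a 0 - a j).toNat := by
      rw [Function.update_of_ne (by omega : (0 : ℕ) ≠ k + 1)]
      refine Finset.sum_lt_sum (fun j _ => ?_) ⟨k + 1, by simpa using hk, ?_⟩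
      · rcases eq_or_ne j (k + 1) with rfl | hne
        · rw [Function.update_self]
          omega
        · rw [Function.update_of_ne hne]
      · rw [Function.update_self]
        omega
    rcases Nat.lt_or_ge (k + 1) (d * (n - d)) with hk' | hk'
    · exact (existsUnique_congr fun g => g.row_benderKnuth_iff hk' hdesc (hflat hk')).1
        (ih _ hlt hpath (hc.benderKnuth hk') rfl)
    · obtain hkr : k + 1 = d * (n - d) := by omega
      have h := ih _ hlt hpath hc rfl
      rw [hkr] at h
      exact (existsUnique_congr fun g => g.row_update_top_iff hc _).1 h

/-- **Unique extension of a path labelling to a cylindrical growth diagram.**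
Fix `0 < d < n`, `r = d*(n−d)`. Given a path `p` through `𝕀` (i.e. `p 0` is on the
diagonal, each step is `(−1,0)` or `(0,1)`, and all points lie in `𝕀`) and Young
diagrams `μ k ∈ Λ(d,n)` with `|μ k| = k`, each obtained from the previous by adding
one box, there is exactly one cylindrical growth diagram `g` with
`g.γ (p k).1 (p k).2 = μ k` for all `k`. -/
theorem stmt3 (d n : ℕ) (hd : 0 < d) (hdn : d < n)
    (p : Fin (d * (n - d) + 1) → ℤ × ℤ)
    (hp0 : (p 0).1 = (p 0).2)
    (hpI : ∀ k, (p k).1 ≤ (p k).2 ∧ (p k).2 ≤ (p k).1 + ((d * (n - d) : ℕ) : ℤ))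
    (hstep : ∀ k : Fin (d * (n - d)),
      p k.succ - p k.castSucc = ((-1 : ℤ), (0 : ℤ)) ∨
      p k.succ - p k.castSucc = ((0 : ℤ), (1 : ℤ)))
    (μ : Fin (d * (n - d) + 1) → YoungDiagram)
    (hμΛ : ∀ k, InLambda d n (μ k))
    (hμcard : ∀ k, (μ k).card = (k : ℕ))
    (hμstep : ∀ k : Fin (d * (n - d)), AddBox (μ k.castSucc) (μ k.succ)) :
    ∃! g : CGD d n, ∀ k, g.γ (p k).1 (p k).2 = μ k := by
  have hr : 0 < d * (n - d) := Nat.mul_pos hd (by omega)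
  have hsnd : ∀ k, (p k).2 = (p k).1 + (k : ℕ) := by
    intro k
    induction k using Fin.induction with
    | zero => simp [hp0]
    | succ k ih =>
      have h := hstep k
      simp only [Prod.ext_iff, Prod.fst_sub, Prod.snd_sub, Fin.val_castSucc] at h ih
      simp only [Fin.val_succ]
      omega
  set a : ℕ → ℤ := fun k => (p (Fin.ofNat _ k)).1 with ha
  set c : ℕ → YoungDiagram :=
    fun k => if k ≤ d * (n - d) then μ (Fin.ofNat _ k) else ⊥ with hc
  have hofNat : ∀ k : Fin (d * (n - d) + 1), Fin.ofNat _ (k : ℕ) = k := fun k =>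
    Fin.ext (Nat.mod_eq_of_lt k.2)
  have ha' : ∀ k : Fin (d * (n - d) + 1), a k = (p k).1 := fun k => by simp only [ha, hofNat]
  have hc' : ∀ k : Fin (d * (n - d) + 1), c k = μ k := fun k => by
    simp only [hc, hofNat, if_pos (Nat.lt_succ_iff.1 k.2)]
  have hpath : IsLevelPath (d * (n - d)) a := by
    intro k hk
    have h := hstep ⟨k, hk⟩
    have h₁ := ha' (Fin.succ ⟨k, hk⟩)
    have h₂ := ha' (Fin.castSucc ⟨k, hk⟩)
    simp only [Prod.ext_iff, Prod.fst_sub, Prod.snd_sub] at h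
    simp only [Fin.val_succ, Fin.val_castSucc] at h₁ h₂
    omega
  have hchain : IsBoxChain d n c := by
    refine ⟨fun k hk => ?_, fun k hk => ?_, fun k hk => ?_, fun k hk => ?_⟩
    · have h := hc' ⟨k, by omega⟩
      exact h ▸ hμΛ _
    · have h := hc' ⟨k, by omega⟩
      exact h ▸ hμcard ⟨k, by omega⟩
    · have h₁ := hc' (Fin.succ ⟨k, hk⟩)
      have h₂ := hc' (Fin.castSucc ⟨k, hk⟩)
      have h := hμstep ⟨k, hk⟩
      rw [← h₁, ← h₂] at h
      exact h
    · exact if_neg (by omega)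
  refine (existsUnique_congr fun g => ?_).1 (hpath.existsUnique_cgd hr hchain)
  constructor
  · intro h k
    have := h k (Nat.lt_succ_iff.1 k.2)
    rwa [hc', ha', CGD.row, ← hsnd] at this
  · intro h k hk
    have := h ⟨k, by omega⟩
    rwa [hsnd, ← ha', ← hc'] at this
end

section
/- Fix integers 0 < d < n and set r = d*(n−d). For every cylindrical growth diagram γ and every (i,j) ∈ 𝕀, one has γ(i,j) = (γ(j, i+r))^C and γ(i+r, j+r) = γ(i,j). -/
/-- The complement `μ^C` of `μ` inside the `d × (n−d)` rectangle: the cells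
`(i,j)` with `i < d`, `j < n−d` and `(d−1−i, n−d−1−j) ∉ μ`. -/
def complYD (d n : ℕ) (μ : YoungDiagram) : YoungDiagram where
  cells := (Finset.range d ×ˢ Finset.range (n - d)).filter
      (fun c => (d - 1 - c.1, n - d - 1 - c.2) ∉ μ)
  isLowerSet := by
    intro a b hba ha
    simp only [Finset.coe_filter, Set.mem_setOf_eq, Finset.mem_product,
      Finset.mem_range] at ha ⊢
    obtain ⟨⟨h1, h2⟩, h3⟩ := ha
    refine ⟨⟨lt_of_le_of_lt hba.1 h1, lt_of_le_of_lt hba.2 h2⟩, fun hmem => h3 ?_⟩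
    exact μ.isLowerSet
      (Prod.mk_le_mk.2 ⟨Nat.sub_le_sub_left hba.1 _, Nat.sub_le_sub_left hba.2 _⟩)
      hmem

/-- One step of a tandem queue whose partial sums of queue lengths are `T`: an arrival joins
queue `0`, and a service at `v` moves one customer (if any) from queue `v` to queue `v + 1`. -/
def queueStep (a : Bool) (z : Option ℕ) (T : ℕ → ℕ) : ℕ → ℕ := fun l =>
  if a then (if l = 0 then T l else T l + 1)
  else match z with
    | none => T l
    | some v => if l = v + 1 ∧ T v < T (v + 1) then T l - 1 else T l

/-- The queue which grows (together with its server) in a step of the tandem queue. -/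
def queueOut (a : Bool) (z : Option ℕ) (T : ℕ → ℕ) : Option ℕ :=
  if a then some 0
  else match z with
    | none => none
    | some v => if T v < T (v + 1) then some (v + 1) else some v

/-- Partial sums of the queue lengths after `t` steps, starting from empty queues. -/
def queue (A : ℕ → Bool) (z : ℕ → Option ℕ) : ℕ → ℕ → ℕ
  | 0 => fun _ => 0
  | t + 1 => queueStep (A t) (z t) (queue A z t)

/-- The output of the tandem queue with arrivals `A` and services `z`. -/
def queueOutput (A : ℕ → Bool) (z : ℕ → Option ℕ) (t : ℕ) : Option ℕ :=
  queueOut (A t) (z t) (queue A z t)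

/-- Partial sums of a sequence of queue lengths. -/
def IsPartialSums (T : ℕ → ℕ) : Prop := T 0 = 0 ∧ ∀ l, T l ≤ T (l + 1)

theorem IsPartialSums.queueStep {T : ℕ → ℕ} (h : IsPartialSums T) (a : Bool) (z : Option ℕ) :
    IsPartialSums (queueStep a z T) := by
  obtain ⟨h0, h1⟩ := h
  refine ⟨?_, fun l => ?_⟩
  · cases a <;> cases z <;> simp [_root_.queueStep, h0]
  · have := h1 l
    cases a <;> cases z <;> simp only [_root_.queueStep] <;> grind

theorem isPartialSums_queue (A : ℕ → Bool) (z : ℕ → Option ℕ) (t : ℕ) :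
    IsPartialSums (queue A z t) := by
  induction t with
  | zero => exact ⟨rfl, fun _ => le_rfl⟩
  | succ t ih => exact ih.queueStep _ _

/-- The queues with partial sums `T₂`, served by the outputs of the queues with partial sums `T₁`,
are dominated by the latter up to the defect `D`. -/
def QueueDominated (T₁ T₂ : ℕ → ℕ) (D : ℤ) : Prop :=
  ∀ l, (T₂ (l + 1) : ℤ) ≤ T₁ l + D

theorem QueueDominated.step {T₁ T₂ : ℕ → ℕ} {D : ℤ} (h₁ : IsPartialSums T₁)
    (h₂ : IsPartialSums T₂) (h : QueueDominated T₁ T₂ D) {a b : Bool} {z : Option ℕ}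
    (hb : b = true → a = false ∧ z = none) (ha : a = true → z = none)
    (hD : 0 ≤ D + (if a then 1 else 0) - (if b then 1 else 0)) :
    QueueDominated (queueStep b z T₁) (queueStep a (queueOut b z T₁) T₂)
      (D + (if a then 1 else 0) - (if b then 1 else 0)) := by
  obtain ⟨h10, h1⟩ := h₁
  obtain ⟨h20, h2⟩ := h₂
  intro l
  have hl := h l
  cases b with
  | true =>
    obtain ⟨rfl, rfl⟩ := hb rfl
    simp only [queueStep, queueOut] at *
    rcases l with _ | l <;> simp at * <;> grind
  | false =>
    cases a with
    | true =>
      obtain rfl := ha rfl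
      simp [queueStep] at *
      omega
    | false =>
      cases z with
      | none => simpa [queueStep, queueOut] using hl
      | some v =>
        have hv := h (l - 1)
        have h1v := h1 v
        have h2v := h2 v
        have h2l := h2 l
        simp only [queueStep, queueOut] at *
        by_cases hlv : l = v + 1
        · subst hlv
          simp at *
          grind
        · by_cases hlv' : l = v
          · subst hlv'
            by_cases hT : T₁ l < T₁ (l + 1) <;> simp [hT] <;> grind
          · simp
            grind

/-- A second pair of tandem queues obtained from the pair `T₁`, `T₂` by moving one customer of the
`k`-th queue of the first to the `k`-th queue of the second. -/
structure QueueTransfer (k : ℕ) (T₁ T₂ S₁ S₂ : ℕ → ℕ) (D : ℤ) : Prop where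
  left : IsPartialSums T₁
  right : IsPartialSums T₂
  lt : T₁ k < T₁ (k + 1)
  left_eq : ∀ l, T₁ l = S₁ l + if k < l then 1 else 0
  right_eq : ∀ l, S₂ l = T₂ l + if k < l then 1 else 0
  le : ∀ l, (T₂ (l + 1) : ℤ) + (if k < l then 1 else 0) ≤ T₁ l + D
  eq : (T₂ (k + 1) : ℤ) = T₁ k + D

theorem QueueTransfer.step_server_arrival {k : ℕ} {T₁ T₂ S₁ S₂ : ℕ → ℕ} {D : ℤ}
    (h : QueueTransfer k T₁ T₂ S₁ S₂ D) (hD : 1 ≤ D) :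
    queueOut false (some 0) T₂ = queueOut false (some 0) S₂ ∧
    QueueTransfer k (queueStep true none T₁) (queueStep false (some 0) T₂)
      (queueStep true none S₁) (queueStep false (some 0) S₂) (D - 1) := by
  have H1 := h.left.queueStep true none
  have H2 := h.right.queueStep false (some 0)
  obtain ⟨⟨h10, h1⟩, ⟨h20, h2⟩, hlt, hl, hr, hle, heq⟩ := h
  have hl0 := hl 0
  have hr0 := hr 0
  have hr1 := hr 1
  have hle0 := hle 0
  have key : T₂ 0 < T₂ 1 ↔ S₂ 0 < S₂ 1 := by
    rcases k with _ | k <;> simp at * <;> omega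
  refine ⟨by simp [queueOut, key], H1, H2, ?_, fun l => ?_, fun l => ?_, fun l => ?_, ?_⟩
  · simp only [queueStep]; grind
  · have := hl l
    simp only [queueStep]; grind
  · have := hr l
    simp only [queueStep]; grind
  · have := hle l
    simp only [queueStep]; grind
  · simp only [queueStep]; grind

theorem QueueTransfer.step_arrival {k : ℕ} {T₁ T₂ S₁ S₂ : ℕ → ℕ} {D : ℤ}
    (h : QueueTransfer k T₁ T₂ S₁ S₂ D) (x : Option ℕ) :
    QueueTransfer k T₁ (queueStep true x T₂) S₁ (queueStep true x S₂) (D + 1) := by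
  have H2 := h.right.queueStep true x
  obtain ⟨h1, ⟨h20, h2⟩, hlt, hl, hr, hle, heq⟩ := h
  refine ⟨h1, H2, hlt, hl, fun l => ?_, fun l => ?_, ?_⟩
  · have := hr l
    simp only [queueStep]; grind
  · have := hle l
    simp only [queueStep]; grind
  · simp only [queueStep]; grind

theorem QueueTransfer.step_serve {k : ℕ} {T₁ T₂ S₁ S₂ : ℕ → ℕ} {D : ℤ}
    (h : QueueTransfer k T₁ T₂ S₁ S₂ D) (v : ℕ) :
    queueOut false (queueOut false (some v) T₁) T₂ =
      queueOut false (queueOut false (some v) S₁) S₂ ∧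
    ∃ k', QueueTransfer k' (queueStep false (some v) T₁)
      (queueStep false (queueOut false (some v) T₁) T₂)
      (queueStep false (some v) S₁) (queueStep false (queueOut false (some v) S₁) S₂) D := by
  have H1 := h.left.queueStep false (some v)
  have H2 := h.right.queueStep false (queueOut false (some v) T₁)
  obtain ⟨⟨h10, h1⟩, ⟨h20, h2⟩, hlt, hl, hr, hle, heq⟩ := h
  have hlv := hl v
  have hlv' := hl (v + 1)
  by_cases hvk : v = k ∧ T₁ (k + 1) = T₁ k + 1
  · obtain ⟨rfl, hT⟩ := hvk
    have e1 : queueOut false (some v) T₁ = some (v + 1) := by simp [queueOut, hlt]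
    have e2 : queueOut false (some v) S₁ = some v := by
      simp [queueOut]; simp at hlv hlv'; omega
    have hlev := hle (v + 1)
    have hr0 := hr v
    have hr1 := hr (v + 1)
    have h2v := h2 v
    have h2v' := h2 (v + 1)
    simp at hlv hlv' hlev hr0 hr1
    have n1 : ¬ T₂ (v + 1) < T₂ (v + 1 + 1) := by omega
    have n2 : S₂ v < S₂ (v + 1) := by omega
    have n3 : ¬ S₁ v < S₁ (v + 1) := by omega
    rw [e1] at H2
    rw [e1, e2]
    refine ⟨by simp [queueOut, n1, n2], v + 1, H1, H2, ?_, fun l => ?_, fun l => ?_,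
      fun l => ?_, ?_⟩
    · have := h1 (v + 1)
      simp [queueStep, hlt]; omega
    · have := hl l
      simp [queueStep, hlt, n3]; grind
    · have := hr l
      simp [queueStep, n1, n2]; grind
    · have := hle l
      simp [queueStep, n1, hlt]; grind
    · simp [queueStep, n1, hlt]; grind
  · have key : T₁ v < T₁ (v + 1) ↔ S₁ v < S₁ (v + 1) := by grind
    have e : queueOut false (some v) S₁ = queueOut false (some v) T₁ := by
      simp [queueOut, key]
    obtain ⟨x, hx⟩ : ∃ x, queueOut false (some v) T₁ = some x := by
      simp only [queueOut]; grind
    have hxv : x = if T₁ v < T₁ (v + 1) then v + 1 else v := by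
      simp only [queueOut] at hx; grind
    have hrx := hr x
    have hrx' := hr (x + 1)
    have key2 : T₂ x < T₂ (x + 1) ↔ S₂ x < S₂ (x + 1) := by
      by_cases hxk : x = k
      · have := hle v
        grind
      · grind
    rw [hx] at H2
    rw [e, hx]
    refine ⟨by simp [queueOut, key2], k, H1, H2, ?_, fun l => ?_, fun l => ?_,
      fun l => ?_, ?_⟩
    · have := h1 (v + 1)
      simp [queueStep]; grind
    · have := hl l
      simp [queueStep]; grind
    · have := hr l
      simp [queueStep]; grind
    · have := hle l
      have := hle (l - 1)
      have := h2 (l + 1)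
      have := h2 l
      have := h2 x
      simp [queueStep]; grind
    · simp [queueStep]; grind

@[simp] theorem queueStep_false_none (T : ℕ → ℕ) : queueStep false none T = T := rfl

theorem QueueTransfer.step {k : ℕ} {T₁ T₂ S₁ S₂ : ℕ → ℕ} {D : ℤ}
    (h : QueueTransfer k T₁ T₂ S₁ S₂ D) {a b : Bool} {z : Option ℕ}
    (hb : b = true → a = false ∧ z = none) (ha : a = true → z = none)
    (hD : 0 ≤ D + (if a then 1 else 0) - (if b then 1 else 0)) :
    queueOut a (queueOut b z T₁) T₂ = queueOut a (queueOut b z S₁) S₂ ∧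
    ∃ k', QueueTransfer k' (queueStep b z T₁) (queueStep a (queueOut b z T₁) T₂)
      (queueStep b z S₁) (queueStep a (queueOut b z S₁) S₂)
      (D + (if a then 1 else 0) - (if b then 1 else 0)) := by
  cases b with
  | true =>
    obtain ⟨rfl, rfl⟩ := hb rfl
    have := h.step_server_arrival (by simp at hD; omega)
    refine ⟨this.1, k, ?_⟩
    simpa [queueOut] using this.2
  | false =>
    cases a with
    | true =>
      obtain rfl := ha rfl
      exact ⟨rfl, k, by simpa [queueOut] using h.step_arrival none⟩
    | false =>
      cases z with
      | none => exact ⟨rfl, k, by simpa [queueOut] using h⟩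
      | some v =>
        obtain ⟨h1, k', h2⟩ := h.step_serve v
        exact ⟨h1, k', by simpa using h2⟩

/-- Consecutive queue sizes `β ≤ α` are controlled by the arrivals; moving the arrival at time `τ`
from the first stage to the second one does not change the final output. -/
theorem queueOutput_transfer {A A' B B' : ℕ → Bool} {z : ℕ → Option ℕ} {α β : ℕ → ℤ} {τ : ℕ}
    (hα : ∀ t, α (t + 1) = α t + if A t then 1 else 0)
    (hβ : ∀ t, β (t + 1) = β t + if B t then 1 else 0)
    (hB : ∀ t, B t = true → A t = false ∧ z t = none) (hA : ∀ t, A t = true → z t = none)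
    (hτ : B τ = true) (hA' : ∀ t, A' t = if t = τ then true else A t)
    (hB' : ∀ t, B' t = if t = τ then false else B t)
    (h_le : ∀ t ≤ τ, β t ≤ α t) (h_eq : β τ = α τ) (h_gt : ∀ t, τ < t → β t ≤ α t + 1) (t : ℕ) :
    queueOutput A (queueOutput B z) t = queueOutput A' (queueOutput B' z) t := by
  have before : ∀ t ≤ τ, queue B z t = queue B' z t ∧
      queue A (queueOutput B z) t = queue A' (queueOutput B' z) t ∧
      QueueDominated (queue B z t) (queue A (queueOutput B z) t) (α t - β t) := by
    intro t
    induction t with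
    | zero =>
      intro _
      refine ⟨rfl, rfl, fun l => ?_⟩
      have := h_le 0 (Nat.zero_le _)
      simp [queue]
      omega
    | succ t ih =>
      intro ht
      obtain ⟨e1, e2, e3⟩ := ih (by omega)
      have hA't : A' t = A t := by rw [hA', if_neg (by omega)]
      have hB't : B' t = B t := by rw [hB', if_neg (by omega)]
      refine ⟨by simp [queue, e1, hB't], by simp [queue, queueOutput, e1, e2, hA't, hB't], ?_⟩
      have hD : α (t + 1) - β (t + 1) =
          α t - β t + (if A t then 1 else 0) - (if B t then 1 else 0) := by
        rw [hα, hβ]; ring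
      rw [hD]
      refine e3.step (isPartialSums_queue _ _ _) (isPartialSums_queue _ _ _) (hB t) (hA t) ?_
      have := h_le _ ht
      omega
  obtain ⟨hAτ, hzτ⟩ := hB τ hτ
  have hA'τ : A' τ = true := by simp [hA']
  have hB'τ : B' τ = false := by simp [hB']
  obtain ⟨q1, q2, q3⟩ := before τ le_rfl
  have hzero := q3 0
  rw [(isPartialSums_queue B z τ).1, h_eq] at hzero
  have hp1 := isPartialSums_queue B z τ
  have hp2 := isPartialSums_queue A (queueOutput B z) τ
  have after : ∀ t, ∃ k, QueueTransfer k (queue B z (τ + 1 + t))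
      (queue A (queueOutput B z) (τ + 1 + t)) (queue B' z (τ + 1 + t))
      (queue A' (queueOutput B' z) (τ + 1 + t)) (α (τ + 1 + t) - β (τ + 1 + t) + 1) := by
    intro t
    induction t with
    | zero =>
      refine ⟨0, isPartialSums_queue _ _ _, isPartialSums_queue _ _ _, ?_, fun l => ?_, fun l => ?_,
        fun l => ?_, ?_⟩
      · simp only [queue, queueStep, hτ, hzτ]
        have := hp1.1; have := hp1.2 0
        grind
      · simp only [queue, queueStep, hτ, hzτ, hB'τ, ← q1]
        grind
      · simp only [queue, queueOutput, queueStep, queueOut, hτ, hzτ, hAτ, hA'τ, hB'τ, ← q2]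
        have := hp2.1
        grind
      · simp only [queue, queueOutput, queueStep, queueOut, hτ, hzτ, hAτ, hα, hβ]
        have := hp2.1; have := q3 l
        grind
      · simp only [queue, queueOutput, queueStep, queueOut, hτ, hzτ, hAτ, hα, hβ]
        have := hp2.1; have := hp1.1
        have := hp2.2 0
        grind
    | succ t ih =>
      obtain ⟨k, ih⟩ := ih
      rw [← add_assoc]
      set s := τ + 1 + t with hs
      have hA's : A' s = A s := by rw [hA', if_neg (by omega)]
      have hB's : B' s = B s := by rw [hB', if_neg (by omega)]
      have hD : α (s + 1) - β (s + 1) + 1 =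
          α s - β s + 1 + (if A s then 1 else 0) - (if B s then 1 else 0) := by
        rw [hα, hβ]; ring
      rw [hD]
      simp only [queue, queueOutput, hA's, hB's]
      refine (ih.step (hB s) (hA s) ?_).2
      have := h_gt (s + 1) (by omega)
      omega
  rcases lt_trichotomy t τ with ht | rfl | ht
  · obtain ⟨e1, e2, -⟩ := before t ht.le
    have hA't : A' t = A t := by rw [hA', if_neg (by omega)]
    have hB't : B' t = B t := by rw [hB', if_neg (by omega)]
    simp [queueOutput, e1, e2, hA't, hB't]
  · simp only [queueOutput, queueOut, hτ, hzτ, hAτ, hA'τ]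
    have := hp2.1
    grind
  · obtain ⟨s, rfl⟩ := Nat.exists_eq_add_of_lt ht
    have hs : τ + s + 1 = τ + 1 + s := by ring
    rw [hs] at ht ⊢
    obtain ⟨k, h⟩ := after s
    set s := τ + 1 + s with hs
    have hA's : A' s = A s := by rw [hA', if_neg (by omega)]
    have hB's : B' s = B s := by rw [hB', if_neg (by omega)]
    simp only [queueOutput, hA's, hB's]
    refine (h.step (hB s) (hA s) ?_).1
    have := h_gt (s + 1) (by omega)
    rw [hα, hβ] at this
    omega

/-- The output of the first `n` stages of a series of tandem queues, where the letter `d - 1 - k`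
of the word `u` is an arrival at stage `k`, and the outputs of a stage are the services of the
next one. Letters that are at least `d` are ignored. -/
def wordOutput (d : ℕ) (u : ℕ → ℕ) : ℕ → ℕ → Option ℕ
  | 0 => fun _ => none
  | n + 1 => queueOutput (fun t => decide (u t + n + 1 = d)) (wordOutput d u n)

theorem queueOut_isSome (a : Bool) (z : Option ℕ) (T : ℕ → ℕ) :
    (queueOut a z T).isSome = (a || z.isSome) := by
  cases a <;> cases z <;> simp [queueOut]
  split <;> simp

theorem wordOutput_isSome (d : ℕ) (u : ℕ → ℕ) (n t : ℕ) :
    (wordOutput d u n t).isSome = true ↔ u t < d ∧ d ≤ u t + n := by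
  induction n with
  | zero => simp [wordOutput]
  | succ n ih =>
    simp only [wordOutput, queueOutput, queueOut_isSome, Bool.or_eq_true, ih, decide_eq_true_eq]
    omega

theorem wordOutput_eq_none {d : ℕ} {u : ℕ → ℕ} {n t : ℕ} (h : u t + n < d) :
    wordOutput d u n t = none := by
  have := wordOutput_isSome d u n t
  rw [← Option.not_isSome_iff_eq_none, this]
  omega

theorem wordOutput_transfer {d a τ : ℕ} {u u' : ℕ → ℕ} {α β : ℕ → ℤ} (had : a + 1 < d)
    (hne : ∀ t, t ≠ τ → u' t = u t) (hu : u τ = a + 1) (hu' : u' τ = a)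
    (hα : ∀ t, α (t + 1) = α t + if u t = a then 1 else 0)
    (hβ : ∀ t, β (t + 1) = β t + if u t = a + 1 then 1 else 0)
    (h_le : ∀ t ≤ τ, β t ≤ α t) (h_eq : β τ = α τ) (h_gt : ∀ t, τ < t → β t ≤ α t + 1) :
    wordOutput d u d = wordOutput d u' d := by
  obtain ⟨p, rfl⟩ : ∃ p, d = p + 2 + a := ⟨d - a - 2, by omega⟩
  set d := p + 2 + a with hd
  have low : ∀ n ≤ p, wordOutput d u n = wordOutput d u' n := by
    intro n
    induction n with
    | zero => intro _; rfl
    | succ n ih =>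
      intro hn
      simp only [wordOutput, ih (by omega)]
      congr 1
      funext t
      rcases eq_or_ne t τ with rfl | ht
      · rw [hu, hu', decide_eq_decide]; omega
      · rw [hne t ht]
  have high : ∀ n, wordOutput d u (p + 2 + n) = wordOutput d u' (p + 2 + n) := by
    intro n
    induction n with
    | zero =>
      funext t
      simp only [wordOutput, ← low p le_rfl]
      refine queueOutput_transfer (α := α) (β := β) (τ := τ) (fun t => ?_) (fun t => ?_)
        (fun t h => ⟨?_, ?_⟩) (fun t h => ?_) ?_ (fun t => ?_) (fun t => ?_) h_le h_eq h_gt t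
      · rw [hα]; congr 2; simp; omega
      · rw [hβ]; congr 2; simp; omega
      · simp at h ⊢; omega
      · simp at h; exact wordOutput_eq_none (by omega)
      · simp at h; exact wordOutput_eq_none (by omega)
      · simp; omega
      · rcases eq_or_ne t τ with rfl | ht
        · simp [hu']; omega
        · simp [hne t ht, ht]
      · rcases eq_or_ne t τ with rfl | ht
        · simp [hu']; omega
        · simp [hne t ht, ht]
    | succ n ih =>
      rw [← add_assoc]
      simp only [wordOutput, ih]
      congr 1
      funext t
      rcases eq_or_ne t τ with rfl | ht
      · rw [hu, hu', decide_eq_decide]; omega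
      · rw [hne t ht]
  exact high a

set_option maxHeartbeats 1000000 in
/-- The output of a word is invariant under sliding a hole `s` through the chain of row lengths
described by the word. -/
theorem wordOutput_slide {d : ℕ} {u u' s : ℕ → ℕ} {lam kap : ℕ → ℕ → ℕ}
    (hlam : ∀ t, ∀ b < d, lam (t + 1) b = lam t b + if u t = b then 1 else 0)
    (hkap : ∀ t, ∀ b < d, kap (t + 1) b = kap t b + if u' t = b then 1 else 0)
    (hlam_anti : ∀ t b, b + 1 < d → lam t (b + 1) ≤ lam t b)
    (hkap_anti : ∀ t b, b + 1 < d → kap t (b + 1) ≤ kap t b)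
    (hs : ∀ t, s t < d) (hlk : ∀ t, ∀ b < d, lam t b = kap t b + if b = s t then 1 else 0)
    (hstep : ∀ t, (u' t = u t ∧ s (t + 1) = s t) ∨
      (u t = s t + 1 ∧ u' t = s t ∧ s (t + 1) = s t + 1 ∧ kap t (s t) = kap t (s t + 1))) :
    wordOutput d u d = wordOutput d u' d := by
  have hmono : Monotone s := monotone_nat_of_le_succ fun t => by rcases hstep t with h | h <;> omega
  set hyb : ℕ → ℕ → ℕ := fun a t => if u' t ≠ u t ∧ u' t < a then u' t else u t with hhyb
  have key : ∀ a, wordOutput d u d = wordOutput d (hyb a) d := by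
    intro a
    induction a with
    | zero => simp [hhyb]
    | succ a ih =>
      rw [ih]
      by_cases hex : ∃ τ, u' τ ≠ u τ ∧ u' τ = a
      · obtain ⟨τ, hτ, hτa⟩ := hex
        obtain ⟨h1, h2, h3, h4⟩ := (hstep τ).resolve_left fun h => hτ h.1
        have hsτ : s τ = a := by omega
        have had : a + 1 < d := by have := hs (τ + 1); omega
        have hle : ∀ t ≤ τ, s t ≤ a := fun t ht => hsτ ▸ hmono ht
        have hgt : ∀ t, τ < t → a + 1 ≤ s t := fun t ht => by
          have := hmono (Nat.succ_le_of_lt ht)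
          simp only [Nat.succ_eq_add_one] at this
          omega
        have huniq : ∀ t, u' t ≠ u t → u' t = a → t = τ := fun t h h' => by
          obtain ⟨-, k2, k3, -⟩ := (hstep t).resolve_left fun k => h k.1
          by_contra hne
          rcases lt_or_gt_of_ne hne with h | h
          · have := hle (t + 1) (by omega); omega
          · have := hgt t h; omega
        refine wordOutput_transfer (a := a) (τ := τ)
          (α := fun t => kap t a - if τ < t then 1 else 0) (β := fun t => lam t (a + 1)) had
          (fun t ht => ?_) ?_ ?_ (fun t => ?_) (fun t => ?_) (fun t ht => ?_) ?_ (fun t ht => ?_)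
        · have := huniq t
          simp only [hhyb]; grind
        · simp only [hhyb]; grind
        · simp only [hhyb]; grind
        · have := huniq t
          have := hstep t
          have := hkap t a (by omega)
          simp only [hhyb]; grind
        · have := hstep t
          have := hlam t (a + 1) had
          simp only [hhyb]; grind
        · have := hle t ht
          have := hlk t (a + 1) had
          have := hkap_anti t a had
          grind
        · have := hlk τ (a + 1) had
          grind
        · have := hgt t ht
          have := hlk t a (by omega)
          have := hlam_anti t a had
          grind
      · congr 1
        funext t
        simp only [hhyb]
        grind
  rw [key d]
  congr 1
  funext t
  have := hs t
  have := hstep t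
  simp only [hhyb]
  grind

theorem lt_of_wordOutput_eq_some {d : ℕ} {u : ℕ → ℕ} {n t v : ℕ}
    (h : wordOutput d u n t = some v) : v < n := by
  induction n generalizing v with
  | zero => simp [wordOutput] at h
  | succ n ih =>
    simp only [wordOutput, queueOutput, queueOut] at h
    split at h
    · grind
    · split at h
      · simp at h
      · rename_i w hw
        have := ih hw
        grind

theorem queueOut_add_queueStep {T : ℕ → ℕ} (h : IsPartialSums T) {a : Bool} {z : Option ℕ}
    (ha : a = true → z = none) (b : ℕ) :
    (if queueOut a z T = some b then 1 else 0) + queueStep a z T b + T (b + 1) =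
      queueStep a z T (b + 1) + (if z = some b then 1 else 0) + T b := by
  obtain ⟨h0, h1⟩ := h
  have := h1 b
  cases a with
  | true =>
    obtain rfl := ha rfl
    rcases b with _ | b <;> simp [queueOut, queueStep] <;> omega
  | false =>
    rcases z with _ | v
    · simp [queueOut]; omega
    · simp only [queueOut, queueStep]
      grind

theorem count_queueOutput {A : ℕ → Bool} {z : ℕ → Option ℕ} (hA : ∀ t, A t = true → z t = none)
    (t b : ℕ) :
    Nat.count (fun s => queueOutput A z s = some b) t + queue A z t b =
      queue A z t (b + 1) + Nat.count (fun s => z s = some b) t := by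
  induction t with
  | zero => simp [queue]
  | succ t ih =>
    have := queueOut_add_queueStep (isPartialSums_queue A z t) (hA t) b
    rw [Nat.count_succ, Nat.count_succ]
    simp only [queue]
    change _ + (if queueOut (A t) (z t) (queue A z t) = some b then 1 else 0) + _ = _
    omega

/-- The queue of the stage of the letter `d - 1 - n`. -/
def wordQueue (d : ℕ) (u : ℕ → ℕ) (n : ℕ) : ℕ → ℕ → ℕ :=
  queue (fun t => decide (u t + n + 1 = d)) (wordOutput d u n)

section RowLengths

variable {d : ℕ} {u : ℕ → ℕ} {lam : ℕ → ℕ → ℕ}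

theorem wordOutput_of_ballot
    (hlam : ∀ t, ∀ b < d, lam (t + 1) b = lam t b + if u t = b then 1 else 0)
    (hanti : ∀ t b, b + 1 < d → lam t (b + 1) ≤ lam t b) (h0 : ∀ b < d, lam 0 b = 0) {n : ℕ}
    (hn : n ≤ d) (t : ℕ) :
    wordOutput d u n t = if d ≤ u t + n ∧ u t < d then some (u t + n - d) else none := by
  induction n generalizing t with
  | zero => simp [wordOutput]
  | succ n ih =>
    have ih := fun t => ih (by omega) t
    obtain ⟨q, rfl⟩ : ∃ q, d = q + 1 + n := ⟨d - 1 - n, by omega⟩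
    have hgt : ∀ t v, u t = q + v + 1 → v < n → lam t (q + v + 1) < lam t (q + v) := by
      intro t v hu hv
      have h1 := hanti (t + 1) (q + v) (by omega)
      rw [hlam _ _ (by omega), hlam _ _ (by omega), hu] at h1
      simp at h1
      omega
    have hT : ∀ t, ∀ l ≤ n, wordQueue (q + 1 + n) u n t l + lam t (q + l) = lam t q := by
      intro t
      induction t with
      | zero => intro l hl; simp [wordQueue, queue, h0 q (by omega), h0 (q + l) (by omega)]
      | succ t iht =>
        intro l hl
        simp only [wordQueue, queue] at iht ⊢
        simp only [queueStep, hlam t q (by omega), hlam t (q + l) (by omega), ih t]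
        have hl0 := iht l hl
        have hp := (isPartialSums_queue (fun t => decide (u t + n + 1 = q + 1 + n))
          (wordOutput (q + 1 + n) u n) t).1
        by_cases hu : u t = q
        · simp [hu]; grind
        · by_cases hu' : u t < q ∨ q + 1 + n ≤ u t
          · have hd : ¬ (q + 1 + n ≤ u t + n ∧ u t < q + 1 + n) := by omega
            have hd' : ¬ (u t + n + 1 = q + 1 + n) := by omega
            rw [if_neg hd, if_neg hu, if_neg (by omega : ¬ u t = q + l)]
            simpa [hd'] using hl0
          · obtain ⟨v, hv⟩ : ∃ v, u t = q + v + 1 := ⟨u t - q - 1, by omega⟩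
            have hvn : v < n := by omega
            have := hgt t v hv hvn
            have e1 := iht v (by omega)
            have e2 := iht (v + 1) (by omega)
            have hd : q + 1 + n ≤ u t + n ∧ u t < q + 1 + n := by omega
            have hd' : ¬ (u t + n + 1 = q + 1 + n) := by omega
            have hd'' : u t + n - (q + 1 + n) = v := by omega
            rw [← add_assoc] at e2
            rw [if_pos hd, if_neg hu, hd'', if_neg (by simpa using hd')]
            by_cases hlv : l = v + 1
            · subst hlv
              rw [if_pos (by omega : u t = q + (v + 1)), ← add_assoc]
              simp only [true_and]
              rw [if_pos (by omega)]
              omega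
            · rw [if_neg (by omega : ¬ u t = q + l)]
              simp [hlv, hl0]
    simp only [wordOutput, queueOutput, queueOut, ih t]
    by_cases hu : u t = q
    · rw [if_pos (by simp; omega), if_pos (by omega)]
      congr 1; omega
    · by_cases hu' : u t < q ∨ q + 1 + n ≤ u t
      · have hd : ¬ (q + 1 + n ≤ u t + n ∧ u t < q + 1 + n) := by omega
        have hd' : ¬ (u t + n + 1 = q + 1 + n) := by omega
        have hd'' : ¬ (q + 1 + n ≤ u t + (n + 1) ∧ u t < q + 1 + n) := by omega
        rw [if_neg hd, if_neg hd'', if_neg (by simpa using hd')]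
      · obtain ⟨v, hv⟩ : ∃ v, u t = q + v + 1 := ⟨u t - q - 1, by omega⟩
        have hvn : v < n := by omega
        have := hgt t v hv hvn
        have e1 := hT t v (by omega)
        have e2 := hT t (v + 1) (by omega)
        simp only [wordQueue] at e1 e2
        have hd : q + 1 + n ≤ u t + n ∧ u t < q + 1 + n := by omega
        have hd' : ¬ (u t + n + 1 = q + 1 + n) := by omega
        have hd'' : u t + n - (q + 1 + n) = v := by omega
        have hd3 : u t + (n + 1) - (q + 1 + n) = v + 1 := by omega
        have hd4 : q + 1 + n ≤ u t + (n + 1) ∧ u t < q + 1 + n := by omega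
        rw [← add_assoc] at e2
        rw [if_pos hd, if_pos hd4, if_neg (by simpa using hd'), hd'', hd3]
        simp only
        rw [if_pos (by omega)]

theorem count_wordOutput_of_ballot
    (hlam : ∀ t, ∀ b < d, lam (t + 1) b = lam t b + if u t = b then 1 else 0)
    (hanti : ∀ t b, b + 1 < d → lam t (b + 1) ≤ lam t b) (h0 : ∀ b < d, lam 0 b = 0) {b : ℕ}
    (hb : b < d) (t : ℕ) :
    Nat.count (fun s => wordOutput d u d s = some b) t = lam t b := by
  induction t with
  | zero => simp [h0 b hb]
  | succ t ih =>
    rw [Nat.count_succ, ih, hlam t b hb, wordOutput_of_ballot hlam hanti h0 le_rfl]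
    congr 2
    simp
    omega

theorem wordQueue_eq_zero
    (hlam : ∀ t, ∀ b < d, lam (t + 1) b = lam t b + if u t = b then 1 else 0)
    (hanti : ∀ t b, b + 1 < d → lam t (b + 1) ≤ lam t b) {N m : ℕ}
    (hN : ∀ b < d, lam N b = m) {n : ℕ} (hn : n < d) {l : ℕ} (hl : l ≤ n) :
    wordQueue d u n N l = 0 := by
  induction n generalizing l with
  | zero =>
    obtain rfl : l = 0 := by omega
    exact (isPartialSums_queue _ _ _).1
  | succ n ih =>
    rcases l with _ | l
    · exact (isPartialSums_queue _ _ _).1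
    obtain ⟨q, rfl⟩ : ∃ q, d = q + 2 + n := ⟨d - 2 - n, by omega⟩
    have hdom : ∀ t, QueueDominated (wordQueue (q + 2 + n) u n t)
        (wordQueue (q + 2 + n) u (n + 1) t)
        (lam t q - lam t (q + 1)) := by
      intro t
      induction t with
      | zero =>
        intro l
        have := hanti 0 q (by omega)
        simp [wordQueue, queue]
        omega
      | succ t iht =>
        have := hanti (t + 1) q (by omega)
        have e : (lam (t + 1) q - lam (t + 1) (q + 1) : ℤ) = lam t q - lam t (q + 1) +
            (if decide (u t + (n + 1) + 1 = q + 2 + n) then 1 else 0) -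
            (if decide (u t + n + 1 = q + 2 + n) then 1 else 0) := by
          rw [hlam t q (by omega), hlam t (q + 1) (by omega)]
          have i1 : (u t + (n + 1) + 1 = q + 2 + n) ↔ u t = q := by omega
          have i2 : (u t + n + 1 = q + 2 + n) ↔ u t = q + 1 := by omega
          simp only [i1, i2, decide_eq_true_eq]
          push_cast
          ring
        rw [e]
        refine iht.step (isPartialSums_queue _ _ _) (isPartialSums_queue _ _ _)
          (fun h => ⟨?_, ?_⟩) (fun h => ?_) ?_
        · simp at h ⊢; omega
        · simp at h; exact wordOutput_eq_none (by omega)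
        · simp at h; exact wordOutput_eq_none (by omega)
        · rw [← e]; omega
    have h1 := hdom N l
    rw [ih (by omega) (by omega), hN q (by omega), hN (q + 1) (by omega)] at h1
    simpa using h1

theorem wordQueue_eq_of_lt
    (hlam : ∀ t, ∀ b < d, lam (t + 1) b = lam t b + if u t = b then 1 else 0) {n l : ℕ}
    (hn : n < d) (hl : n < l) (t : ℕ) :
    wordQueue d u n t l + lam 0 (d - 1 - n) = lam t (d - 1 - n) := by
  induction t with
  | zero => simp [wordQueue, queue]
  | succ t ih =>
    rw [hlam t _ (by omega), ← ih]
    have hz := fun v => lt_of_wordOutput_eq_some (d := d) (u := u) (n := n) (t := t) (v := v)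
    simp only [wordQueue, queue, queueStep]
    grind

theorem count_wordOutput_of_rectangle
    (hlam : ∀ t, ∀ b < d, lam (t + 1) b = lam t b + if u t = b then 1 else 0)
    (hanti : ∀ t b, b + 1 < d → lam t (b + 1) ≤ lam t b) {N m : ℕ}
    (hN : ∀ b < d, lam N b = m) {b : ℕ} (hb : b < d) :
    Nat.count (fun s => wordOutput d u d s = some b) N + lam 0 (d - 1 - b) = m := by
  have hstep : ∀ n, Nat.count (fun s => wordOutput d u (n + 1) s = some b) N +
      wordQueue d u n N b = wordQueue d u n N (b + 1) +
      Nat.count (fun s => wordOutput d u n s = some b) N :=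
    fun n => count_queueOutput (fun t h => wordOutput_eq_none (by simp at h; omega)) N b
  have hconst : ∀ k, b + 1 + k ≤ d →
      Nat.count (fun s => wordOutput d u (b + 1 + k) s = some b) N =
        Nat.count (fun s => wordOutput d u (b + 1) s = some b) N := by
    intro k
    induction k with
    | zero => intro _; rfl
    | succ k ih =>
      intro hk
      have := hstep (b + 1 + k)
      rw [wordQueue_eq_zero hlam hanti hN (by omega) (by omega),
        wordQueue_eq_zero hlam hanti hN (by omega) (by omega), ih (by omega)] at this
      rw [← add_assoc, ← add_zero (Nat.count _ _), this, zero_add]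
  have hzero : Nat.count (fun s => wordOutput d u b s = some b) N = 0 := by
    rw [Nat.count_iff_forall_not]
    intro t _ h
    exact absurd (lt_of_wordOutput_eq_some h) (lt_irrefl b)
  have h1 := hconst (d - (b + 1)) (by omega)
  rw [Nat.add_sub_cancel' (by omega)] at h1
  have h2 := hstep b
  rw [hzero, wordQueue_eq_zero hlam hanti hN hb le_rfl] at h2
  have h3 := wordQueue_eq_of_lt hlam hb (Nat.lt_succ_self b) N
  rw [hN _ (by omega)] at h3
  simp only [Nat.succ_eq_add_one] at h3
  omega

end RowLengths

theorem YoungDiagram.ext_rowLen {μ ν : YoungDiagram} (h : ∀ b, μ.rowLen b = ν.rowLen b) : μ = ν := by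
  ext ⟨a, x⟩
  rw [YoungDiagram.mem_cells, YoungDiagram.mem_cells, YoungDiagram.mem_iff_lt_rowLen,
    YoungDiagram.mem_iff_lt_rowLen, h]

/-- The row of the box added to `μ` in order to obtain `ν`. -/
def addedRow (μ ν : YoungDiagram) : ℕ := (ν.cells \ μ.cells).sup Prod.fst

theorem AddBox.sdiff_and_rowLen {μ ν : YoungDiagram} (h : AddBox μ ν) :
    ν.cells \ μ.cells = {(addedRow μ ν, μ.rowLen (addedRow μ ν))} ∧
    ∀ b, ν.rowLen b = μ.rowLen b + if addedRow μ ν = b then 1 else 0 := by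
  obtain ⟨hle, hcard⟩ := h
  have hle' : μ.cells ⊆ ν.cells := hle
  have h1 : (ν.cells \ μ.cells).card = 1 := by
    rw [Finset.card_sdiff_of_subset hle']
    simp only [YoungDiagram.card] at hcard
    omega
  obtain ⟨⟨a, x⟩, hc⟩ := Finset.card_eq_one.1 h1
  have hrow : addedRow μ ν = a := by simp [addedRow, hc]
  have hmem : ∀ b y, y < ν.rowLen b ↔ y < μ.rowLen b ∨ (b = a ∧ y = x) := by
    intro b y
    rw [← YoungDiagram.mem_iff_lt_rowLen, ← YoungDiagram.mem_iff_lt_rowLen,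
      ← YoungDiagram.mem_cells, ← YoungDiagram.mem_cells, ← Finset.sdiff_union_of_subset hle', hc]
    simp [or_comm]
  have hx : ¬ x < μ.rowLen a := by
    have : (a, x) ∈ ν.cells \ μ.cells := by simp [hc]
    rw [← YoungDiagram.mem_iff_lt_rowLen]
    exact (Finset.mem_sdiff.1 this).2
  have hx' : x = μ.rowLen a := by
    have h1 : x < ν.rowLen a := (hmem a x).2 (Or.inr ⟨rfl, rfl⟩)
    have h2 := (hmem a (μ.rowLen a)).1 (by omega)
    omega
  refine ⟨by rw [hrow, hc, hx'], fun b => ?_⟩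
  rw [hrow]
  have h1 := hmem b (μ.rowLen b)
  have h2 := hmem b (ν.rowLen b)
  have h3 := hmem b (μ.rowLen b + 1)
  have h4 := hmem b (ν.rowLen b - 1)
  split_ifs with hab
  · subst hab
    simp only [true_and] at h1 h2 h3
    omega
  · simp only [Ne.symm hab, false_and, or_false] at h1 h2
    omega

theorem AddBox.rowLen {μ ν : YoungDiagram} (h : AddBox μ ν) (b : ℕ) :
    ν.rowLen b = μ.rowLen b + if addedRow μ ν = b then 1 else 0 :=
  h.sdiff_and_rowLen.2 b

theorem AddBox.mem {μ ν : YoungDiagram} (h : AddBox μ ν) :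
    (addedRow μ ν, μ.rowLen (addedRow μ ν)) ∈ ν.cells \ μ.cells := by
  rw [h.sdiff_and_rowLen.1]
  exact Finset.mem_singleton_self _

theorem AddBox.addedRow_lt {d n : ℕ} {μ ν : YoungDiagram} (h : AddBox μ ν) (hν : InLambda d n ν) :
    addedRow μ ν < d :=
  (hν _ (Finset.mem_sdiff.1 h.mem).1).1

/-- The local rule of growth diagrams in terms of the rows of the added boxes. -/
theorem addedRow_square {κ κ' μ μ' : YoungDiagram} (h₁ : AddBox κ κ') (h₂ : AddBox κ μ)
    (h₃ : AddBox κ' μ') (h₄ : AddBox μ μ')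
    (hrule : (∃ c₁ ∈ μ'.cells \ κ.cells, ∃ c₂ ∈ μ'.cells \ κ.cells, c₁ ≠ c₂ ∧ ¬ CellAdj c₁ c₂) →
      κ' ≠ μ) :
    (addedRow κ κ' = addedRow μ μ' ∧ addedRow κ' μ' = addedRow κ μ) ∨
    (addedRow μ μ' = addedRow κ μ + 1 ∧ addedRow κ κ' = addedRow κ μ ∧
      addedRow κ' μ' = addedRow κ μ + 1 ∧
      κ.rowLen (addedRow κ μ) = κ.rowLen (addedRow κ μ + 1)) := by
  have e₁ := h₁.rowLen
  have e₂ := h₂.rowLen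
  have e₃ := h₃.rowLen
  have e₄ := h₄.rowLen
  have m₂ := h₂.mem
  have m₄ := h₄.mem
  have l₂ : κ.cells ⊆ μ.cells := h₂.1
  have l₄ : μ.cells ⊆ μ'.cells := h₄.1
  set s := addedRow κ μ
  set s' := addedRow κ' μ'
  set u := addedRow μ μ'
  set u' := addedRow κ κ'
  have hsum : ∀ b, (if u' = b then 1 else 0) + (if s' = b then 1 else 0) =
      (if s = b then 1 else 0) + if u = b then 1 else 0 := by
    intro b
    have := e₁ b; have := e₂ b; have := e₃ b; have := e₄ b
    omega
  by_cases hu : u' = u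
  · left
    refine ⟨hu, ?_⟩
    have := hsum s
    grind
  have hus : u' = s := by
    have := hsum u'
    grind
  have hsu : s' = u := by
    have := hsum s'
    grind
  have hne : u ≠ s := fun h => hu (hus.trans h.symm)
  right
  have hκμ : κ' = μ := YoungDiagram.ext_rowLen fun b => by rw [e₁, e₂, hus]
  have hadj : CellAdj (s, κ.rowLen s) (u, μ.rowLen u) := by
    by_contra hna
    refine hrule ⟨_, ?_, _, ?_, ?_, hna⟩ hκμ
    · exact Finset.mem_sdiff.2 ⟨l₄ (Finset.mem_sdiff.1 m₂).1, (Finset.mem_sdiff.1 m₂).2⟩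
    · exact Finset.mem_sdiff.2 ⟨(Finset.mem_sdiff.1 m₄).1, fun h => (Finset.mem_sdiff.1 m₄).2 (l₂ h)⟩
    · intro h
      exact hne (congrArg Prod.fst h).symm
  have hμu := e₂ u
  have hμs := e₂ s
  rw [if_neg hne.symm, add_zero] at hμu
  rw [if_pos rfl] at hμs
  simp only [CellAdj] at hadj
  have hsu_ne : (s : ℤ) - u ≠ 0 := by omega
  have habs : |(s : ℤ) - u| = 1 ∧ (κ.rowLen s : ℤ) - μ.rowLen u = 0 := by
    have h1 := Int.one_le_abs hsu_ne
    have h2 := abs_nonneg ((κ.rowLen s : ℤ) - μ.rowLen u)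
    exact ⟨by omega, abs_eq_zero.1 (by omega)⟩
  have hsucc : u = s + 1 := by
    rcases abs_eq (zero_le_one' ℤ) |>.1 habs.1 with h | h
    · have := μ.rowLen_anti u s (by omega)
      omega
    · omega
  refine ⟨hsucc, hus, hsu.trans hsucc, ?_⟩
  rw [← hsucc]
  omega

namespace CGD

variable {d n : ℕ} (g : CGD d n)

/-- The row lengths in the row `i` of a growth diagram, starting from column `j` and constant
after `N` steps. -/
def rows (i j : ℤ) (N t : ℕ) : ℕ → ℕ := (g.γ i (j + (min t N : ℕ))).rowLen

/-- The rows of the boxes which are added in the first `N` steps from `(i, j)` to the right,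
followed by letters `d`. -/
def word (i j : ℤ) (N t : ℕ) : ℕ :=
  if t < N then addedRow (g.γ i (j + t)) (g.γ i (j + t + 1)) else d

variable {g} {i j : ℤ} {N : ℕ}

theorem rows_succ (hij : i ≤ j) (hN : j + N ≤ i + ((d * (n - d) : ℕ) : ℤ)) (t : ℕ) :
    ∀ b < d, g.rows i j N (t + 1) b = g.rows i j N t b + if g.word i j N t = b then 1 else 0 := by
  intro b hb
  by_cases ht : t < N
  · have hw : g.word i j N t = addedRow (g.γ i (j + t)) (g.γ i (j + t + 1)) := if_pos ht
    have := (g.grow_right i (j + t) (by omega) (by omega)).rowLen b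
    rw [hw, rows, rows, min_eq_left ht.le, min_eq_left ht, Nat.cast_succ,
      ← add_assoc]
    exact this
  · have hw : g.word i j N t = d := if_neg ht
    rw [hw, rows, rows, min_eq_right (by omega), min_eq_right (by omega), if_neg hb.ne', add_zero]

theorem rows_anti (t b : ℕ) (_ : b + 1 < d) : g.rows i j N t (b + 1) ≤ g.rows i j N t b :=
  YoungDiagram.rowLen_anti _ _ _ (Nat.le_succ b)

theorem wordOutput_word_sub_one (hij : i ≤ j)
    (hN : j + N ≤ (i - 1) + ((d * (n - d) : ℕ) : ℤ)) :
    wordOutput d (g.word (i - 1) j N) d = wordOutput d (g.word i j N) d := by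
  have hup : ∀ t : ℕ, t ≤ N → AddBox (g.γ i (j + t)) (g.γ (i - 1) (j + t)) := fun t ht =>
    g.grow_up i (j + t) (by omega) (by omega)
  have hmin : ∀ t, min t N ≤ N := fun t => min_le_right t N
  refine wordOutput_slide (lam := g.rows (i - 1) j N) (kap := g.rows i j N)
    (s := fun t => addedRow (g.γ i (j + (min t N : ℕ))) (g.γ (i - 1) (j + (min t N : ℕ))))
    (rows_succ (by omega) hN) (rows_succ hij (by omega)) rows_anti rows_anti (fun t => ?_)
    (fun t b _ => ?_) (fun t => ?_)
  · have := hmin t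
    exact (hup _ (hmin t)).addedRow_lt (g.lambda _ _ (by omega) (by omega))
  · have := (hup _ (hmin t)).rowLen b
    simpa only [rows, eq_comm] using this
  · by_cases ht : t < N
    · have hc : j + ((t + 1 : ℕ) : ℤ) = j + t + 1 := by push_cast; ring
      have hup' := hup (t + 1) ht
      simp only [word, rows, if_pos ht, min_eq_left ht.le, min_eq_left (Nat.succ_le_of_lt ht)]
      rw [Nat.succ_eq_add_one] at *
      rw [hc] at hup' ⊢
      exact addedRow_square (g.grow_right _ _ (by omega) (by omega)) (hup t ht.le) hup'
        (g.grow_right _ _ (by omega) (by omega)) (g.nonadj _ _ (by omega) (by omega))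
    · left
      simp only [word, if_neg ht, min_eq_right (not_lt.1 ht),
        min_eq_right ((not_lt.1 ht).trans (Nat.le_succ t)), and_self]

theorem wordOutput_word_eq (k : ℕ) (hN : j + N ≤ (j - k) + ((d * (n - d) : ℕ) : ℤ)) :
    wordOutput d (g.word (j - k) j N) d = wordOutput d (g.word j j N) d := by
  induction k with
  | zero => simp
  | succ k ih =>
    have hk : j - ((k + 1 : ℕ) : ℤ) = j - k - 1 := by push_cast; ring
    rw [hk] at hN ⊢
    rw [wordOutput_word_sub_one (by omega) hN, ih (by omega)]

theorem rowLen_diag (i : ℤ) (b : ℕ) : (g.γ i i).rowLen b = 0 := by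
  have h := g.card_eq i i le_rfl (by omega)
  have h0 : (g.γ i i).cells = ∅ := by
    rw [← Finset.card_eq_zero]
    simpa [YoungDiagram.card] using h
  by_contra hne
  have := YoungDiagram.mem_iff_lt_rowLen.2 (Nat.pos_of_ne_zero hne)
  rw [← YoungDiagram.mem_cells, h0] at this
  simp at this

theorem rowLen_top (i : ℤ) {b : ℕ} (hb : b < d) :
    (g.γ i (i + ((d * (n - d) : ℕ) : ℤ))).rowLen b = n - d := by
  set ν := g.γ i (i + ((d * (n - d) : ℕ) : ℤ)) with hν
  have hcard := g.card_eq i (i + ((d * (n - d) : ℕ) : ℤ)) (by omega) le_rfl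
  have hlam := g.lambda i (i + ((d * (n - d) : ℕ) : ℤ)) (by omega) le_rfl
  have hsub : ν.cells ⊆ Finset.range d ×ˢ Finset.range (n - d) := fun c hc => by
    simpa using hlam c hc
  have heq : ν.cells = Finset.range d ×ˢ Finset.range (n - d) := by
    refine Finset.eq_of_subset_of_card_le hsub ?_
    rw [Finset.card_product, Finset.card_range, Finset.card_range]
    have : (ν.cells.card : ℤ) = ((d * (n - d) : ℕ) : ℤ) := by
      rw [← add_sub_cancel_left i ((d * (n - d) : ℕ) : ℤ)]
      exact hcard
    exact (Nat.cast_injective this).ge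
  have hmem : ∀ x, x < ν.rowLen b ↔ x < n - d := fun x => by
    rw [← YoungDiagram.mem_iff_lt_rowLen, ← YoungDiagram.mem_cells, heq]
    simp [hb]
  have h1 := hmem (ν.rowLen b)
  have h2 := hmem (n - d)
  omega

theorem rowLen_add_rowLen (hij : i ≤ j) (hijr : j ≤ i + ((d * (n - d) : ℕ) : ℤ)) {b : ℕ}
    (hb : b < d) :
    (g.γ j (i + ((d * (n - d) : ℕ) : ℤ))).rowLen b + (g.γ i j).rowLen (d - 1 - b) = n - d := by
  obtain ⟨k, rfl⟩ : ∃ k : ℕ, i = j - k := ⟨(j - i).toNat, by omega⟩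
  set r : ℕ := d * (n - d) with hr
  obtain ⟨N, hN⟩ : ∃ N : ℕ, j + N = j - k + r := ⟨(r - k : ℤ).toNat, by omega⟩
  have hballot := count_wordOutput_of_ballot (rows_succ (g := g) (N := N) le_rfl (by omega))
    rows_anti (fun b _ => by simpa [rows] using rowLen_diag j b) hb N
  have hrect := count_wordOutput_of_rectangle (rows_succ (g := g) (N := N) hij (by omega))
    rows_anti (N := N) (m := n - d)
    (fun b hb => by simpa only [rows, min_self, hN] using rowLen_top (j - k) hb) hb
  rw [wordOutput_word_eq k (by omega), hballot] at hrect
  simpa [rows, hN] using hrect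

end CGD

theorem InLambda.rowLen_eq_zero {d n : ℕ} {μ : YoungDiagram} (h : InLambda d n μ) {b : ℕ}
    (hb : d ≤ b) : μ.rowLen b = 0 := by
  by_contra hne
  have := (h _ (YoungDiagram.mem_iff_lt_rowLen.2 (Nat.pos_of_ne_zero hne))).1
  simp only at this
  omega

theorem eq_complYD {d n : ℕ} {μ ν : YoungDiagram} (hμ : InLambda d n μ)
    (h : ∀ b < d, ν.rowLen b + μ.rowLen (d - 1 - b) = n - d) : μ = complYD d n ν := by
  ext ⟨a, x⟩
  simp only [complYD, Finset.mem_filter, Finset.mem_product, Finset.mem_range,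
    YoungDiagram.mem_iff_lt_rowLen, YoungDiagram.mem_cells]
  by_cases ha : a < d
  · have h1 := h (d - 1 - a) (by omega)
    rw [show d - 1 - (d - 1 - a) = a by omega] at h1
    omega
  · rw [hμ.rowLen_eq_zero (not_lt.1 ha)]
    omega

/-- **Glide-reflection symmetry of cylindrical growth diagrams.** For every
cylindrical growth diagram `g` and every `(i,j) ∈ 𝕀`, one has
`γ(i,j) = (γ(j, i+r))^C` and `γ(i+r, j+r) = γ(i,j)`. -/
theorem stmt5 (d n : ℕ) (hd : 0 < d) (hdn : d < n) (g : CGD d n)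
    (i j : ℤ) (hij : i ≤ j) (hijr : j ≤ i + ((d * (n - d) : ℕ) : ℤ)) :
    g.γ i j = complYD d n (g.γ j (i + ((d * (n - d) : ℕ) : ℤ))) ∧
    g.γ (i + ((d * (n - d) : ℕ) : ℤ)) (j + ((d * (n - d) : ℕ) : ℤ)) = g.γ i j := by
  refine ⟨eq_complYD (g.lambda i j hij hijr) fun b hb => CGD.rowLen_add_rowLen hij hijr hb,
    YoungDiagram.ext_rowLen fun b => ?_⟩
  rcases lt_or_ge b d with hb | hb
  · have h1 := CGD.rowLen_add_rowLen (g := g) hij hijr (b := d - 1 - b) (by omega)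
    have h2 := CGD.rowLen_add_rowLen (g := g) hijr (by omega) hb
    rw [show d - 1 - (d - 1 - b) = b by omega] at h1
    omega
  · rw [(g.lambda i j hij hijr).rowLen_eq_zero hb,
      (g.lambda _ _ (by omega) (by omega)).rowLen_eq_zero hb]
end

section
/- Fix integers 0 < d < n and set r = d*(n−d). Let γ be a cylindrical growth diagram and let (i,j) ∈ ℤ×ℤ with i ≤ j and j+2 ≤ i+r. Let c₁ = (a₁,b₁) be the unique cell of γ(i,j+1) \ γ(i,j) and c₂ = (a₂,b₂) the unique cell of γ(i,j+2) \ γ(i,j+1). If b₂ > b₁ (the second box is added to the northeast of the first), then γ(j, j+2) is the horizontal domino with cells {(0,0),(0,1)}; if a₂ > a₁ (the second box is added to the southwest of the first), then γ(j, j+2) is the vertical domino with cells {(0,0),(1,0)}. -/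
/-- `ν` is obtained from `μ` by adding the box `c`. -/
def AddsCell (μ ν : YoungDiagram) (c : ℕ × ℕ) : Prop :=
  c ∉ μ ∧ ∀ x, x ∈ ν ↔ x = c ∨ x ∈ μ

theorem AddBox.addsCell_of_mem {μ ν : YoungDiagram} (h : AddBox μ ν) {c : ℕ × ℕ}
    (hc : c ∈ ν.cells \ μ.cells) : AddsCell μ ν c := by
  obtain ⟨hle, hcard⟩ := h
  have hsub : μ.cells ⊆ ν.cells := YoungDiagram.cells_subset_iff.mpr hle
  rw [Finset.mem_sdiff] at hc
  have heq : insert c μ.cells = ν.cells := by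
    refine Finset.eq_of_subset_of_card_le (Finset.insert_subset hc.1 hsub) ?_
    rw [Finset.card_insert_of_notMem hc.2]
    exact hcard.le
  refine ⟨fun hm => hc.2 hm, fun x => ?_⟩
  rw [← YoungDiagram.mem_cells, ← heq, Finset.mem_insert, YoungDiagram.mem_cells]

theorem AddBox.exists_addsCell {μ ν : YoungDiagram} (h : AddBox μ ν) :
    ∃ c, AddsCell μ ν c := by
  have hlt : μ.cells.card < ν.cells.card := Nat.lt_of_succ_le h.2.ge
  obtain ⟨c, hc, hc'⟩ := Finset.exists_mem_notMem_of_card_lt_card hlt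
  exact ⟨c, h.addsCell_of_mem (Finset.mem_sdiff.mpr ⟨hc, hc'⟩)⟩

theorem AddsCell.transpose {μ ν : YoungDiagram} {c : ℕ × ℕ} (h : AddsCell μ ν c) :
    AddsCell μ.transpose ν.transpose c.swap := by
  refine ⟨by simpa [YoungDiagram.mem_transpose] using h.1, fun x => ?_⟩
  rw [YoungDiagram.mem_transpose, YoungDiagram.mem_transpose, h.2, Prod.swap_eq_iff_eq_swap]

theorem AddsCell.column_lt_or_row_lt {κ μ ν : YoungDiagram} {c₁ c₂ : ℕ × ℕ}
    (h₁ : AddsCell κ μ c₁) (h₂ : AddsCell μ ν c₂) : c₁.2 < c₂.2 ∨ c₁.1 < c₂.1 := by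
  by_contra! h
  exact h₂.1 (μ.up_left_mem h.2 h.1 ((h₁.2 _).mpr (Or.inl rfl)))

theorem AddsCell.not_column_lt_and_row_lt {κ μ ν : YoungDiagram} {c₁ c₂ : ℕ × ℕ}
    (h₁ : AddsCell κ μ c₁) (h₂ : AddsCell μ ν c₂) : ¬ (c₁.2 < c₂.2 ∧ c₁.1 < c₂.1) := by
  rintro ⟨hcol, hrow⟩
  have hmem : (c₁.1, c₁.2 + 1) ∈ ν :=
    ν.up_left_mem hrow.le hcol ((h₂.2 c₂).mpr (Or.inl rfl))
  rcases (h₂.2 _).mp hmem with h | h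
  · exact hrow.ne (congrArg (·.1) h)
  rcases (h₁.2 _).mp h with h | h
  · exact Nat.succ_ne_self _ (congrArg (·.2) h)
  · exact h₁.1 (κ.up_left_mem le_rfl (Nat.le_succ _) h)

/-- `c'` is the right or lower neighbour of `c`. -/
def NextCell (c c' : ℕ × ℕ) : Prop :=
  c' = (c.1, c.2 + 1) ∨ c' = (c.1 + 1, c.2)

theorem NextCell.swap {c c' : ℕ × ℕ} (h : NextCell c c') : NextCell c.swap c'.swap := by
  rcases h with rfl | rfl
  · exact Or.inr rfl
  · exact Or.inl rfl

/-- How the cells added along the two sides of a growth square are related: either both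
paths add the same two cells in opposite orders, or they add the same two adjacent cells in
the same order. -/
def SquareRule (c x x' c' : ℕ × ℕ) : Prop :=
  (c' = c ∧ x' = x) ∨ (x = c ∧ x' = c' ∧ NextCell c c')

theorem SquareRule.swap {c x x' c' : ℕ × ℕ} (h : SquareRule c x x' c') :
    SquareRule c.swap x.swap x'.swap c'.swap := by
  rcases h with ⟨rfl, rfl⟩ | ⟨rfl, rfl, h⟩
  · exact Or.inl ⟨rfl, rfl⟩
  · exact Or.inr ⟨rfl, rfl, h.swap⟩

theorem AddsCell.nextCell {μ ν ρ : YoungDiagram} {c c' : ℕ × ℕ} (h : AddsCell μ ν c)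
    (h' : AddsCell ν ρ c') (hadj : CellAdj c c') : NextCell c c' := by
  obtain ⟨a, b⟩ := c
  obtain ⟨a', b'⟩ := c'
  have hnot : ¬ (a' ≤ a ∧ b' ≤ b) := fun hle =>
    h'.1 (ν.up_left_mem hle.1 hle.2 ((h.2 _).mpr (Or.inl rfl)))
  simp only [CellAdj] at hadj
  simp only [NextCell, Prod.mk.injEq]
  rcases abs_cases ((a : ℤ) - a') with h₁ | h₁ <;>
    rcases abs_cases ((b : ℤ) - b') with h₂ | h₂ <;> omega

theorem squareRule_of_nonadj {κ μ ν ρ : YoungDiagram} {c x x' c' : ℕ × ℕ}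
    (hc : AddsCell κ μ c) (hx : AddsCell κ ν x) (hx' : AddsCell μ ρ x')
    (hc' : AddsCell ν ρ c')
    (hne : (∃ u ∈ ρ.cells \ κ.cells, ∃ v ∈ ρ.cells \ κ.cells, u ≠ v ∧ ¬ CellAdj u v) →
      μ ≠ ν) : SquareRule c x x' c' := by
  have hρ : ∀ y, (y = x' ∨ y = c ∨ y ∈ κ) ↔ (y = c' ∨ y = x ∨ y ∈ κ) := fun y => by
    rw [← hc.2, ← hx.2, ← hx'.2, ← hc'.2]
  have hx'μ := hx'.1
  have hc'ν := hc'.1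
  rw [hc.2] at hx'μ
  rw [hx.2] at hc'ν
  push Not at hx'μ hc'ν
  have hcκ := hc.1
  have hxκ := hx.1
  by_cases hxc : x = c
  · subst hxc
    have hx'c' : x' = c' := by grind
    subst hx'c'
    have hμν : μ = ν := SetLike.ext fun y => by rw [hc.2, hx.2]
    refine Or.inr ⟨rfl, rfl, hc.nextCell hx' ?_⟩
    by_contra hadj
    refine hne ⟨x, ?_, x', ?_, hx'μ.1.symm, hadj⟩ hμν
    · simp [hx'.2, hc.2, hcκ]
    · simp [hx'.2, hx'μ.2]
  · exact Or.inl (by grind)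

theorem column_lt_of_squareRule {κ₀ κ₁ κ₂ μ₁ μ₂ : YoungDiagram}
    {c₁ c₂ e₁ e₂ x₀ x₁ x₂ : ℕ × ℕ}
    (hc₁ : AddsCell κ₀ κ₁ c₁) (hc₂ : AddsCell κ₁ κ₂ c₂)
    (he₂ : AddsCell μ₁ μ₂ e₂) (hx₁ : AddsCell κ₁ μ₁ x₁) (hx₂ : AddsCell κ₂ μ₂ x₂)
    (s₁ : SquareRule c₁ x₀ x₁ e₁) (s₂ : SquareRule c₂ x₁ x₂ e₂)
    (hlt : c₁.2 < c₂.2) : e₁.2 < e₂.2 := by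
  rcases s₁ with ⟨rfl, rfl⟩ | ⟨rfl, rfl, n₁⟩ <;> rcases s₂ with ⟨rfl, rfl⟩ | ⟨rfl, rfl, n₂⟩
  · exact hlt
  · rcases n₂ with rfl | rfl
    · exact Nat.lt_succ_of_lt hlt
    · exact hlt
  · rcases n₁ with rfl | rfl
    · by_contra hcon
      obtain ⟨a, b⟩ := e₂
      obtain ⟨a₀, b₀⟩ := x₀
      obtain rfl : b = b₀ + 1 := by dsimp only at hlt hcon; omega
      have hmem : (a₀, b₀ + 1) ∈ μ₁ := (hx₁.2 _).mpr (Or.inl rfl)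
      have ha : a₀ < a := by
        by_contra h
        exact he₂.1 (μ₁.up_left_mem (not_lt.mp h) le_rfl hmem)
      have hmem₂ : (a₀, b₀ + 1) ∈ κ₂ :=
        κ₂.up_left_mem ha.le le_rfl ((hc₂.2 _).mpr (Or.inl rfl))
      rcases (hc₂.2 _).mp hmem₂ with h | h
      · exact ha.ne (congrArg (·.1) h)
      · exact hx₁.1 h
    · exact hlt
  · rcases n₁ with rfl | rfl
    · rcases n₂ with rfl | rfl
      · exact Nat.lt_succ_self _
      · obtain ⟨a, b⟩ := x₀
        have hmem : (a + 1, b) ∈ μ₂ :=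
          μ₂.up_left_mem le_rfl (Nat.le_succ b) ((hx₂.2 _).mpr (Or.inl rfl))
        have hmem₀ : (a + 1, b) ∈ κ₀ := by
          simpa [hx₂.2, hc₂.2, hc₁.2] using hmem
        exact absurd (κ₀.up_left_mem (Nat.le_succ a) le_rfl hmem₀) hc₁.1
    · exact absurd hlt (lt_irrefl _)

theorem row_lt_of_squareRule {κ₀ κ₁ κ₂ μ₁ μ₂ : YoungDiagram}
    {c₁ c₂ e₁ e₂ x₀ x₁ x₂ : ℕ × ℕ}
    (hc₁ : AddsCell κ₀ κ₁ c₁) (hc₂ : AddsCell κ₁ κ₂ c₂)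
    (he₂ : AddsCell μ₁ μ₂ e₂) (hx₁ : AddsCell κ₁ μ₁ x₁) (hx₂ : AddsCell κ₂ μ₂ x₂)
    (s₁ : SquareRule c₁ x₀ x₁ e₁) (s₂ : SquareRule c₂ x₁ x₂ e₂)
    (hlt : c₁.1 < c₂.1) : e₁.1 < e₂.1 :=
  column_lt_of_squareRule hc₁.transpose hc₂.transpose he₂.transpose
    hx₁.transpose hx₂.transpose s₁.swap s₂.swap hlt

theorem horizontal_domino {κ μ ν : YoungDiagram} {c₁ c₂ : ℕ × ℕ} (hκ : κ = ⊥)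
    (h₁ : AddsCell κ μ c₁) (h₂ : AddsCell μ ν c₂) (hlt : c₁.2 < c₂.2) :
    ∀ x, x ∈ ν ↔ x = (0, 0) ∨ x = (0, 1) := by
  subst hκ
  have hμ : ∀ x, x ∈ μ ↔ x = c₁ := fun x => by simp [h₁.2]
  obtain rfl : (0, 0) = c₁ := (hμ _).mp
    (μ.up_left_mem (Nat.zero_le _) (Nat.zero_le _) ((hμ c₁).mpr rfl))
  have hmem : (0, 1) ∈ ν :=
    ν.up_left_mem (Nat.zero_le _) hlt ((h₂.2 c₂).mpr (Or.inl rfl))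
  obtain rfl : (0, 1) = c₂ := by simpa [h₂.2, hμ] using hmem
  intro x
  rw [h₂.2, hμ, or_comm]

theorem vertical_domino {κ μ ν : YoungDiagram} {c₁ c₂ : ℕ × ℕ} (hκ : κ = ⊥)
    (h₁ : AddsCell κ μ c₁) (h₂ : AddsCell μ ν c₂) (hlt : c₁.1 < c₂.1) :
    ∀ x, x ∈ ν ↔ x = (0, 0) ∨ x = (1, 0) := by
  intro x
  have h := horizontal_domino (by rw [hκ]; ext; simp) h₁.transpose h₂.transpose hlt x.swap
  simpa [YoungDiagram.mem_transpose, Prod.swap_eq_iff_eq_swap] using h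

namespace CGD

variable {d n : ℕ} (g : CGD d n)

theorem γ_self (j : ℤ) : g.γ j j = ⊥ := by
  have h : (g.γ j j).cells = ∅ := by
    rw [← Finset.card_eq_zero]
    have := g.card_eq j j le_rfl (by omega)
    rw [sub_self] at this
    exact_mod_cast this
  exact YoungDiagram.ext (by rw [h, YoungDiagram.cells_bot])

theorem squareRule {i j : ℤ} (hij : i ≤ j)
    (hr : j + 1 ≤ (i - 1) + ((d * (n - d) : ℕ) : ℤ)) {c x x' c' : ℕ × ℕ}
    (hc : AddsCell (g.γ i j) (g.γ i (j + 1)) c)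
    (hx : AddsCell (g.γ i j) (g.γ (i - 1) j) x)
    (hx' : AddsCell (g.γ i (j + 1)) (g.γ (i - 1) (j + 1)) x')
    (hc' : AddsCell (g.γ (i - 1) j) (g.γ (i - 1) (j + 1)) c') : SquareRule c x x' c' :=
  squareRule_of_nonadj hc hx hx' hc' (g.nonadj i j hij hr)

theorem column_lt_and_horizontal_or_row_lt_and_vertical {i j : ℤ} (hij : i ≤ j) :
    j + 2 ≤ i + ((d * (n - d) : ℕ) : ℤ) → ∀ c₁ c₂ : ℕ × ℕ,
    AddsCell (g.γ i j) (g.γ i (j + 1)) c₁ → AddsCell (g.γ i (j + 1)) (g.γ i (j + 2)) c₂ →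
    (c₁.2 < c₂.2 ∧ ∀ x, x ∈ g.γ j (j + 2) ↔ x = (0, 0) ∨ x = (0, 1)) ∨
    (c₁.1 < c₂.1 ∧ ∀ x, x ∈ g.γ j (j + 2) ↔ x = (0, 0) ∨ x = (1, 0)) := by
  induction i, hij using Int.leInductionDown with
  | base =>
    intro _ c₁ c₂ h₁ h₂
    exact (h₁.column_lt_or_row_lt h₂).imp
      (fun h => ⟨h, horizontal_domino (g.γ_self j) h₁ h₂ h⟩)
      (fun h => ⟨h, vertical_domino (g.γ_self j) h₁ h₂ h⟩)
  | pred i hij ih =>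
    intro hr e₁ e₂ he₁ he₂
    have h2 : j + 1 + 1 = j + 2 := by ring
    obtain ⟨x₀, hx₀⟩ := (g.grow_up i j hij (by omega)).exists_addsCell
    obtain ⟨x₁, hx₁⟩ := (g.grow_up i (j + 1) (by omega) (by omega)).exists_addsCell
    obtain ⟨x₂, hx₂⟩ := (g.grow_up i (j + 2) (by omega) (by omega)).exists_addsCell
    obtain ⟨c₁, hc₁⟩ := (g.grow_right i j hij (by omega)).exists_addsCell
    obtain ⟨c₂, hc₂⟩ := (g.grow_right i (j + 1) (by omega) (by omega)).exists_addsCell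
    have s₁ := g.squareRule hij (by omega) hc₁ hx₀ hx₁ he₁
    have s₂ := g.squareRule (by omega) (by omega) hc₂ hx₁ (h2 ▸ hx₂) (h2 ▸ he₂)
    rw [h2] at hc₂
    exact (ih (by omega) c₁ c₂ hc₁ hc₂).imp
      (And.imp_left (column_lt_of_squareRule hc₁ hc₂ he₂ hx₁ hx₂ s₁ s₂))
      (And.imp_left (row_lt_of_squareRule hc₁ hc₂ he₂ hx₁ hx₂ s₁ s₂))

end CGD

/-- **Dominoes appear at the diagonal (jeu de taquin for two boxes).** Let `g` be a
cylindrical growth diagram, `i ≤ j` with `j + 2 ≤ i + r`. Let `c₁` be the cell of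
`γ(i,j+1) \ γ(i,j)` and `c₂` the cell of `γ(i,j+2) \ γ(i,j+1)`. If `c₂` is
northeast of `c₁` (larger column) then `γ(j,j+2)` is the horizontal domino
`{(0,0),(0,1)}`; if `c₂` is southwest of `c₁` (larger row) then `γ(j,j+2)` is the
vertical domino `{(0,0),(1,0)}`. -/
theorem stmt6 (d n : ℕ) (hd : 0 < d) (hdn : d < n) (g : CGD d n)
    (i j : ℤ) (hij : i ≤ j) (hijr : j + 2 ≤ i + ((d * (n - d) : ℕ) : ℤ))
    (c₁ c₂ : ℕ × ℕ)
    (hc₁ : c₁ ∈ (g.γ i (j + 1)).cells \ (g.γ i j).cells)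
    (hc₂ : c₂ ∈ (g.γ i (j + 2)).cells \ (g.γ i (j + 1)).cells) :
    (c₁.2 < c₂.2 → (g.γ j (j + 2)).cells = {(0, 0), (0, 1)}) ∧
    (c₁.1 < c₂.1 → (g.γ j (j + 2)).cells = {(0, 0), (1, 0)}) := by
  have h₁ := (g.grow_right i j hij (by omega)).addsCell_of_mem hc₁
  have h := g.grow_right i (j + 1) (by omega) (by omega)
  rw [show j + 1 + 1 = j + 2 by ring] at h
  have h₂ := h.addsCell_of_mem hc₂
  have hexcl := h₁.not_column_lt_and_row_lt h₂
  rcases g.column_lt_and_horizontal_or_row_lt_and_vertical hij hijr c₁ c₂ h₁ h₂ with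
    ⟨hlt, hx⟩ | ⟨hlt, hx⟩
  · refine ⟨fun _ => ?_, fun hlt' => absurd ⟨hlt, hlt'⟩ hexcl⟩
    ext x
    simpa using hx x
  · refine ⟨fun hlt' => absurd ⟨hlt', hlt⟩ hexcl, fun _ => ?_⟩
    ext x
    simpa using hx x
end

section
/- Let μ ⊆ ν ⊆ π be Young diagrams, δ a standard Young tableau of shape ν/μ and ε a standard Young tableau of shape π/ν. If the shuffle of (δ, ε) is (ε', δ') — where ε' is a standard tableau of shape ν'/μ and δ' is a standard tableau of shape π/ν' for some Young diagram ν' — then the shuffle of (ε', δ') is (δ, ε). -/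
/-- A growth diagram on the rectangle `[a,b] × [c,e]`: a map `γ` on the rectangle
(normalized to `⊥` off it) into Young diagrams with `γ i (j+1)` and `γ (i−1) j`
obtained from `γ i j` by adding one box, and such that whenever the two cells of
`γ (i−1) (j+1) \ γ i j` are nonadjacent, `γ i (j+1) ≠ γ (i−1) j`. -/
structure GrowthDiagram (a b c e : ℤ) where
  γ : ℤ → ℤ → YoungDiagram
  junk : ∀ i j : ℤ, ¬ (a ≤ i ∧ i ≤ b ∧ c ≤ j ∧ j ≤ e) → γ i j = ⊥
  grow_right : ∀ i j : ℤ, a ≤ i → i ≤ b → c ≤ j → j + 1 ≤ e →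
    AddBox (γ i j) (γ i (j + 1))
  grow_up : ∀ i j : ℤ, a ≤ i - 1 → i ≤ b → c ≤ j → j ≤ e →
    AddBox (γ i j) (γ (i - 1) j)
  nonadj : ∀ i j : ℤ, a ≤ i - 1 → i ≤ b → c ≤ j → j + 1 ≤ e →
    (∃ c₁ ∈ (γ (i - 1) (j + 1)).cells \ (γ i j).cells,
      ∃ c₂ ∈ (γ (i - 1) (j + 1)).cells \ (γ i j).cells, c₁ ≠ c₂ ∧ ¬ CellAdj c₁ c₂) →
    γ i (j + 1) ≠ γ (i - 1) j

/-- A standard Young tableau of shape `ν/μ`, encoded as a chain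
`μ = T 0 ⊆ T 1 ⊆ ⋯ ⊆ T (|ν|−|μ|) = ν` adding one box at each step. -/
def IsSYTChain (μ ν : YoungDiagram) (T : ℕ → YoungDiagram) : Prop :=
  μ ≤ ν ∧ T 0 = μ ∧ T (ν.card - μ.card) = ν ∧
    ∀ t : ℕ, t < ν.card - μ.card → AddBox (T t) (T (t + 1))

/-- `IsShuffle m q p δ ε ε' δ'`: the shuffle of the pair `(δ, ε)` — where `δ` is a
standard tableau of shape `ν/μ` and `ε` one of shape `π/ν`, with `m = |μ|`,
`q = |ν|`, `p = |π|` — equals `(ε', δ')`.  It is witnessed by a growth diagram on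
`[−(p−q), 0] × [m, q]` with right column `δ`, top row `ε`, bottom row `ε'` read
along the left of the column `m`, and left column `δ'`. -/
def IsShuffle (m q p : ℕ) (δ ε ε' δ' : ℕ → YoungDiagram) : Prop :=
  ∃ g : GrowthDiagram (-((p - q : ℕ) : ℤ)) 0 (m : ℤ) (q : ℤ),
    (∀ t : ℕ, t ≤ q - m → g.γ 0 ((m : ℤ) + t) = δ t) ∧
    (∀ t : ℕ, t ≤ p - q → g.γ (-(t : ℤ)) (q : ℤ) = ε t) ∧
    (∀ t : ℕ, t ≤ p - q → g.γ (-(t : ℤ)) (m : ℤ) = ε' t) ∧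
    (∀ t : ℕ, t ≤ q - m → g.γ (-((p - q : ℕ) : ℤ)) ((m : ℤ) + t) = δ' t)

/-- The transpose of a growth diagram: reflecting the rectangle in the antidiagonal
`i + j = n` exchanges the two growth conditions and preserves the local rule. -/
def GrowthDiagram.transpose {a b c e : ℤ} (g : GrowthDiagram a b c e) (n : ℤ)
    {a' b' c' e' : ℤ} (ha : a' = n - e) (hb : b' = n - c) (hc : c' = n - b) (he : e' = n - a) :
    GrowthDiagram a' b' c' e' where
  γ i j := g.γ (n - j) (n - i)
  junk i j h := g.junk _ _ fun h' => h (by omega)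
  grow_right i j h₁ h₂ h₃ h₄ := by
    have := g.grow_up (n - j) (n - i) (by omega) (by omega) (by omega) (by omega)
    rwa [sub_sub] at this
  grow_up i j h₁ h₂ h₃ h₄ := by
    have := g.grow_right (n - j) (n - i) (by omega) (by omega) (by omega) (by omega)
    rwa [show n - i + 1 = n - (i - 1) by ring] at this
  nonadj i j h₁ h₂ h₃ h₄ h := by
    have := g.nonadj (n - j) (n - i) (by omega) (by omega) (by omega) (by omega)
    rw [sub_sub, show n - i + 1 = n - (i - 1) by ring] at this
    exact (this h).symm

/-- **Shuffling is an involution.** Let `μ ⊆ ν ⊆ π` be Young diagrams, `δ` a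
standard tableau of shape `ν/μ` and `ε` one of shape `π/ν`. If the shuffle of
`(δ, ε)` is `(ε', δ')`, then the shuffle of `(ε', δ')` is `(δ, ε)`. -/
theorem stmt11 (μ ν π : YoungDiagram) (hμν : μ ≤ ν) (hνπ : ν ≤ π)
    (δ ε ε' δ' : ℕ → YoungDiagram)
    (hδ : IsSYTChain μ ν δ) (hε : IsSYTChain ν π ε)
    (hsh : IsShuffle μ.card ν.card π.card δ ε ε' δ') :
    IsShuffle μ.card (μ.card + (π.card - ν.card)) π.card ε' δ' δ ε := by
  obtain ⟨g, hright, htop, hbot, hleft⟩ := hsh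
  have hm := Finset.card_le_card (YoungDiagram.cells_subset_iff.mpr hμν)
  have hq := Finset.card_le_card (YoungDiagram.cells_subset_iff.mpr hνπ)
  change μ.card ≤ ν.card at hm
  change ν.card ≤ π.card at hq
  generalize μ.card = m, ν.card = q, π.card = p at *
  refine ⟨g.transpose m (by omega) (by omega) (by omega) (by omega), fun t ht => ?_,
    fun t ht => ?_, fun t ht => ?_, fun t ht => ?_⟩ <;> simp only [GrowthDiagram.transpose]
  · rw [← hbot t (by omega)]; congr 1 <;> omega
  · rw [← hleft t (by omega)]; congr 1 <;> omega
  · rw [← hright t (by omega)]; congr 1 <;> omega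
  · rw [← htop t (by omega)]; congr 1 <;> omega
end
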